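/- arXiv:math/0609763 — 3 statements merged into one kernel-verified Lean document; each statement's English description precedes it below -/
import Mathlib

section
/- Let k₁, k₂ ∈ ℤ and let f be a holomorphic Hilbert modular form of weight (k₁,k₂) for Γ_F = SL₂(𝒪_F). If it is not the case that both k₁ > 0 and k₂ > 0, and not the case that k₁ = k₂ = 0, then f vanishes identically. If k₁ = k₂ = 0, then f is constant. -/
/-- The real number obtained by applying the embedding `σ : F → ℝ` to an entry of a
matrix `γ ∈ SL₂(𝒪_F)`. -/
noncomputable def slEmbEntry {F : Type*} [Field F] [NumberField F] (σ : F →+* ℝ)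
    (γ : Matrix.SpecialLinearGroup (Fin 2) (NumberField.RingOfIntegers F)) (i j : Fin 2) : ℝ :=
  σ (algebraMap (NumberField.RingOfIntegers F) F (γ.1 i j))

/-- The product of two upper half planes. -/
def HH : Set (ℂ × ℂ) := {p : ℂ × ℂ | 0 < p.1.im ∧ 0 < p.2.im}

/-- Every point may be moved, without changing imaginary parts or the value of `h`,
to a point with real parts bounded by `R`. -/
def PerProp (h : ℂ × ℂ → ℂ) (R : ℝ) : Prop :=
  ∀ p ∈ HH, ∃ q : ℂ × ℂ, |q.1.re| ≤ R ∧ |q.2.re| ≤ R ∧ q.1.im = p.1.im ∧ q.2.im = p.2.im ∧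
    h q = h p

lemma isOpen_HH : IsOpen HH := by
  have h1 : IsOpen {p : ℂ × ℂ | 0 < p.1.im} :=
    isOpen_lt continuous_const (Complex.continuous_im.comp continuous_fst)
  have h2 : IsOpen {p : ℂ × ℂ | 0 < p.2.im} :=
    isOpen_lt continuous_const (Complex.continuous_im.comp continuous_snd)
  exact h1.inter h2

/-- A compact box. -/
def box (R α β : ℝ) : Set (ℂ × ℂ) :=
  ((Set.Icc (-R) R) ×ℂ (Set.Icc α β)) ×ˢ ((Set.Icc (-R) R) ×ℂ (Set.Icc α β))

lemma isCompact_box (R α β : ℝ) : IsCompact (box R α β) :=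
  (isCompact_Icc.reProdIm isCompact_Icc).prod (isCompact_Icc.reProdIm isCompact_Icc)

lemma mem_box {R α β : ℝ} {p : ℂ × ℂ} : p ∈ box R α β ↔
    |p.1.re| ≤ R ∧ p.1.im ∈ Set.Icc α β ∧ |p.2.re| ≤ R ∧ p.2.im ∈ Set.Icc α β := by
  simp [box, Complex.mem_reProdIm, abs_le, and_assoc]

lemma box_subset {R α β : ℝ} (hα : 0 < α) : box R α β ⊆ HH := by
  intro p hp
  rw [mem_box] at hp
  exact ⟨hα.trans_le hp.2.1.1, hα.trans_le hp.2.2.2.1⟩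

lemma per_bdd {h : ℂ × ℂ → ℂ} {R : ℝ} (hc : ContinuousOn h HH) (hp : PerProp h R)
    {α β : ℝ} (hα : 0 < α) :
    ∃ B : ℝ, 0 < B ∧ ∀ p : ℂ × ℂ, p.1.im ∈ Set.Icc α β → p.2.im ∈ Set.Icc α β → ‖h p‖ ≤ B := by
  obtain ⟨B, hB⟩ := (isCompact_box R α β).exists_bound_of_continuousOn
    (hc.mono (box_subset hα))
  refine ⟨max B 1, by positivity, fun p h1 h2 => ?_⟩
  obtain ⟨q, a, b, c, d, e⟩ := hp p ⟨hα.trans_le h1.1, hα.trans_le h2.1⟩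
  rw [← e]
  exact (hB q (mem_box.2 ⟨a, c ▸ h1, b, d ▸ h2⟩)).trans (le_max_left _ _)

/-- Three lines theorem on a tube domain. -/
lemma three_lines {h : ℂ × ℂ → ℂ} {R : ℝ} (hd : DifferentiableOn ℂ h HH) (hp : PerProp h R)
    {a₁ a₂ b₁ b₂ A B s : ℝ} (ha₁ : 0 < a₁) (ha₂ : 0 < a₂) (hb₁ : 0 < b₁) (hb₂ : 0 < b₂)
    (hA : ∀ p : ℂ × ℂ, p.1.im = a₁ → p.2.im = a₂ → ‖h p‖ ≤ A)
    (hB : ∀ p : ℂ × ℂ, p.1.im = b₁ → p.2.im = b₂ → ‖h p‖ ≤ B)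
    (hs0 : 0 ≤ s) (hs1 : s ≤ 1) (p : ℂ × ℂ) (h1 : p.1.im = (1 - s) * a₁ + s * b₁)
    (h2 : p.2.im = (1 - s) * a₂ + s * b₂) : ‖h p‖ ≤ A ^ (1 - s) * B ^ s := by
  let L : ℂ → ℂ × ℂ := fun w =>
    (p.1.re + Complex.I * (a₁ + w * (b₁ - a₁) : ℂ), p.2.re + Complex.I * (a₂ + w * (b₂ - a₂) : ℂ))
  have him1 : ∀ w, (L w).1.im = (1 - w.re) * a₁ + w.re * b₁ := by
    intro w; simp [L]; ring
  have him2 : ∀ w, (L w).2.im = (1 - w.re) * a₂ + w.re * b₂ := by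
    intro w; simp [L]; ring
  have hLd : Differentiable ℂ L := by
    intro w
    dsimp only [L]
    fun_prop
  have hmem : ∀ w : ℂ, w.re ∈ Set.Icc (0 : ℝ) 1 → L w ∈ HH := by
    intro w hw
    refine ⟨?_, ?_⟩
    · rw [him1]
      rcases eq_or_lt_of_le hw.1 with h0 | h0
      · rw [← h0]; simpa using ha₁
      · have : 0 ≤ (1 - w.re) * a₁ := mul_nonneg (by linarith [hw.2]) ha₁.le
        have : 0 < w.re * b₁ := mul_pos h0 hb₁
        linarith
    · rw [him2]
      rcases eq_or_lt_of_le hw.1 with h0 | h0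
      · rw [← h0]; simpa using ha₂
      · have : 0 ≤ (1 - w.re) * a₂ := mul_nonneg (by linarith [hw.2]) ha₂.le
        have : 0 < w.re * b₂ := mul_pos h0 hb₂
        linarith
  have hps : L s = p := by
    apply Prod.ext
    · apply Complex.ext
      · simp [L]
      · rw [him1, h1]; simp
    · apply Complex.ext
      · simp [L]
      · rw [him2, h2]; simp
  have key := Complex.HadamardThreeLines.norm_le_interp_of_mem_verticalClosedStrip₀₁'
    (fun w => h (L w)) (z := (s : ℂ)) (a := A) (b := B) ?_ ?_ ?_ ?_ ?_
  · simpa [hps] using key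
  · simp [Complex.HadamardThreeLines.verticalClosedStrip, hs0, hs1]
  · have hD : DifferentiableOn ℂ (fun w => h (L w)) (L ⁻¹' HH) :=
      hd.comp hLd.differentiableOn (fun w hw => hw)
    have hcl : closure (Complex.HadamardThreeLines.verticalStrip 0 1) ⊆ L ⁻¹' HH := by
      intro w hw
      apply hmem
      have : IsClosed (Complex.re ⁻¹' Set.Icc (0 : ℝ) 1) := isClosed_Icc.preimage Complex.continuous_re
      have hsub : Complex.HadamardThreeLines.verticalStrip 0 1 ⊆ Complex.re ⁻¹' Set.Icc (0 : ℝ) 1 :=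
        fun v (hv : v.re ∈ Set.Ioo (0 : ℝ) 1) => Set.Ioo_subset_Icc_self hv
      exact closure_minimal hsub this hw
    exact (hD.mono hcl).diffContOnCl
  · set α := min (min a₁ b₁) (min a₂ b₂)
    set β := max (max a₁ b₁) (max a₂ b₂)
    obtain ⟨M, -, hM⟩ := per_bdd hd.continuousOn hp (α := α) (β := β) (by positivity)
    refine ⟨M, ?_⟩
    rintro _ ⟨w, hw, rfl⟩
    have hw0 : 0 ≤ w.re := hw.1
    have hw1 : w.re ≤ 1 := hw.2
    have e1 : α ≤ a₁ := (min_le_left _ _).trans (min_le_left _ _)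
    have e2 : α ≤ b₁ := (min_le_left _ _).trans (min_le_right _ _)
    have e3 : α ≤ a₂ := (min_le_right _ _).trans (min_le_left _ _)
    have e4 : α ≤ b₂ := (min_le_right _ _).trans (min_le_right _ _)
    have e5 : a₁ ≤ β := (le_max_left _ _).trans (le_max_left _ _)
    have e6 : b₁ ≤ β := (le_max_right _ _).trans (le_max_left _ _)
    have e7 : a₂ ≤ β := (le_max_left _ _).trans (le_max_right _ _)
    have e8 : b₂ ≤ β := (le_max_right _ _).trans (le_max_right _ _)
    apply hM
    · rw [him1]; constructor <;> nlinarith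
    · rw [him2]; constructor <;> nlinarith
  · intro w hw
    have hw : w.re = 0 := hw
    exact hA _ (by rw [him1, hw]; ring) (by rw [him2, hw]; ring)
  · intro w hw
    have hw : w.re = 1 := hw
    exact hB _ (by rw [him1, hw]; ring) (by rw [him2, hw]; ring)

lemma unit_iter {h : ℂ × ℂ → ℂ} {l c : ℝ} (hl : 1 < l)
    (hu : ∀ p ∈ HH, ‖h ((l : ℂ) * p.1, ((l⁻¹ : ℝ) : ℂ) * p.2)‖ = c * ‖h p‖) (n : ℕ) :
    ∀ p ∈ HH, ‖h (((l ^ n : ℝ) : ℂ) * p.1, (((l⁻¹) ^ n : ℝ) : ℂ) * p.2)‖ = c ^ n * ‖h p‖ := by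
  induction n with
  | zero => intro p _; simp
  | succ n ih =>
    intro p hp
    have hl0 : 0 < l := by linarith
    have hq : (((l ^ n : ℝ) : ℂ) * p.1, (((l⁻¹) ^ n : ℝ) : ℂ) * p.2) ∈ HH := by
      refine ⟨?_, ?_⟩
      · rw [Complex.im_ofReal_mul]; exact mul_pos (by positivity) hp.1
      · rw [Complex.im_ofReal_mul]; exact mul_pos (by positivity) hp.2
    have := hu _ hq
    rw [ih p hp] at this
    rw [pow_succ c, mul_comm (c ^ n) c, mul_assoc, ← this]
    congr 2
    apply Prod.ext <;> simp <;> ring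

/-- Growth along a sequence going to infinity in the first variable. -/
lemma growth {h : ℂ × ℂ → ℂ} {R l c : ℝ} (hd : DifferentiableOn ℂ h HH) (hp : PerProp h R)
    (hl : 1 < l) (hc : 0 < c)
    (hu : ∀ p ∈ HH, ‖h ((l : ℂ) * p.1, ((l⁻¹ : ℝ) : ℂ) * p.2)‖ = c * ‖h p‖)
    {y : ℝ} (hy : 0 < y) :
    ∃ K : ℝ, 0 < K ∧ ∀ n : ℕ, ∀ p : ℂ × ℂ, p.1.im = (1 + l ^ n) / 2 → p.2.im = y →
      ‖h p‖ ≤ K * (max c 1) ^ n := by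
  obtain ⟨K, hK0, hK⟩ := per_bdd hd.continuousOn hp (α := min 1 y) (β := max 1 (2 * y))
    (by positivity)
  refine ⟨K, hK0, fun n p h1 h2 => ?_⟩
  have hl0 : 0 < l := by linarith
  have hli : 0 < l⁻¹ ^ n := by positivity
  have hli1 : l⁻¹ ^ n ≤ 1 := pow_le_one₀ (by positivity) (inv_le_one_of_one_le₀ hl.le)
  set P2 : ℝ := 2 * y / (1 + l⁻¹ ^ n) with hP2
  have hP2pos : 0 < P2 := by positivity
  have hP2a : y ≤ P2 := by rw [hP2, le_div_iff₀ (by positivity)]; nlinarith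
  have hP2b : P2 ≤ 2 * y := by rw [hP2, div_le_iff₀ (by positivity)]; nlinarith
  have hbd : ∀ p : ℂ × ℂ, p.1.im = 1 → p.2.im = P2 → ‖h p‖ ≤ K := by
    intro q hq1 hq2
    apply hK
    · rw [hq1]; exact ⟨min_le_left _ _, le_max_left _ _⟩
    · rw [hq2]; exact ⟨(min_le_right _ _).trans hP2a, hP2b.trans (le_max_right _ _)⟩
  have hm1 : (1 : ℝ) ≤ max c 1 := le_max_right _ _
  have hcm : c ^ n ≤ max c 1 ^ n := pow_le_pow_left₀ hc.le (le_max_left _ _) n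
  have hm1n : (1 : ℝ) ≤ max c 1 ^ n := one_le_pow₀ hm1
  have hbd2 : ∀ p : ℂ × ℂ, p.1.im = l ^ n → p.2.im = l⁻¹ ^ n * P2 →
      ‖h p‖ ≤ K * (max c 1) ^ n := by
    intro q hq1 hq2
    set q' : ℂ × ℂ := (((l⁻¹ ^ n : ℝ) : ℂ) * q.1, ((l ^ n : ℝ) : ℂ) * q.2) with hq'
    have i1 : q'.1.im = 1 := by
      rw [hq', Complex.im_ofReal_mul, hq1, ← mul_pow, inv_mul_cancel₀ hl0.ne', one_pow]
    have i2 : q'.2.im = P2 := by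
      rw [hq', Complex.im_ofReal_mul, hq2, ← mul_assoc, ← mul_pow, mul_inv_cancel₀ hl0.ne', one_pow,
        one_mul]
    have := unit_iter hl hu n q' ⟨by rw [i1]; exact one_pos, by rw [i2]; exact hP2pos⟩
    have e : (((l ^ n : ℝ) : ℂ) * q'.1, (((l⁻¹) ^ n : ℝ) : ℂ) * q'.2) = q := by
      have hne : ((l : ℂ)) ≠ 0 := by exact_mod_cast hl0.ne'
      apply Prod.ext
      · simp [hq']; field_simp
      · simp [hq']; field_simp
    rw [e] at this
    rw [this, mul_comm]
    exact mul_le_mul (hbd _ i1 i2) hcm (by positivity) hK0.le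
  have := three_lines hd hp one_pos hP2pos (by positivity) (by positivity)
    (fun q a b => (hbd q a b).trans (le_mul_of_one_le_right hK0.le hm1n)) hbd2 (s := 1 / 2)
    (by norm_num) (by norm_num) p (by rw [h1]; ring) (by rw [h2, hP2]; field_simp; norm_num)
  refine this.trans (le_of_eq ?_)
  rw [← Real.rpow_add (by positivity)]
  norm_num

/-- The sup norm on horizontal slices is nonincreasing in the first imaginary part. -/
lemma mono_first {h : ℂ × ℂ → ℂ} {R l c : ℝ} (hd : DifferentiableOn ℂ h HH) (hp : PerProp h R)
    (hl : 1 < l) (hc : 0 < c)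
    (hu : ∀ p ∈ HH, ‖h ((l : ℂ) * p.1, ((l⁻¹ : ℝ) : ℂ) * p.2)‖ = c * ‖h p‖)
    {a y C : ℝ} (ha : 0 < a) (hy : 0 < y)
    (hC : ∀ p : ℂ × ℂ, p.1.im = a → p.2.im = y → ‖h p‖ ≤ C)
    (p : ℂ × ℂ) (hp1 : a ≤ p.1.im) (hp2 : p.2.im = y) : ‖h p‖ ≤ C := by
  obtain ⟨K, hK0, hK⟩ := growth hd hp hl hc hu hy
  have hC0 : 0 ≤ C := (norm_nonneg _).trans (hC (⟨0, a⟩, ⟨0, y⟩) rfl rfl)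
  -- pass to positive bounds
  suffices H : ∀ D : ℝ, C < D → ‖h p‖ ≤ D from le_of_forall_gt_imp_ge_of_dense H
  intro D hD
  have hD0 : 0 < D := hC0.trans_lt hD
  set m : ℝ := max c 1
  have hm0 : 0 < m := lt_of_lt_of_le one_pos (le_max_right _ _)
  set t : ℝ := p.1.im - a with ht
  have ht0 : 0 ≤ t := by linarith
  let b : ℕ → ℝ := fun n => (1 + l ^ n) / 2
  let s : ℕ → ℝ := fun n => t / (b n - a)
  have hln : Filter.Tendsto (fun n : ℕ => l ^ n) Filter.atTop Filter.atTop :=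
    tendsto_pow_atTop_atTop_of_one_lt hl
  have hb : Filter.Tendsto b Filter.atTop Filter.atTop :=
    (Filter.tendsto_atTop_add_const_left _ _ hln).atTop_div_const (by norm_num)
  have hba : Filter.Tendsto (fun n => b n - a) Filter.atTop Filter.atTop :=
    Filter.tendsto_atTop_add_const_right _ _ hb
  have hs : Filter.Tendsto s Filter.atTop (nhds 0) := hba.const_div_atTop t
  have hns : Filter.Tendsto (fun n : ℕ => (n : ℝ) * s n) Filter.atTop (nhds 0) := by
    have h1 : Filter.Tendsto (fun n : ℕ => (n : ℝ) / l ^ n) Filter.atTop (nhds 0) := by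
      simpa using tendsto_pow_const_div_const_pow_of_one_lt 1 hl
    have h2 : Filter.Tendsto (fun n : ℕ => l ^ n / (b n - a)) Filter.atTop (nhds 2) := by
      have h3 : Filter.Tendsto (fun n : ℕ => 2 - (2 * (1 / 2 - a)) / (b n - a)) Filter.atTop
          (nhds (2 - 0)) := tendsto_const_nhds.sub (hba.const_div_atTop _)
      rw [sub_zero] at h3
      refine h3.congr' ?_
      filter_upwards [hba.eventually_gt_atTop 0] with n hn
      have : b n - a ≠ 0 := hn.ne'
      field_simp
      simp only [b]
      ring
    have h4 := (h1.mul h2).const_mul t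
    simp only [zero_mul, mul_zero] at h4
    refine h4.congr' ?_
    filter_upwards [hba.eventually_gt_atTop 0] with n hn
    have : l ^ n ≠ 0 := by positivity
    have h5 : b n - a ≠ 0 := hn.ne'
    simp only [s]
    field_simp
  have hlim : Filter.Tendsto (fun n : ℕ => D ^ (1 - s n) * (K * m ^ n) ^ (s n)) Filter.atTop
      (nhds D) := by
    have e : ∀ n : ℕ, D ^ (1 - s n) * (K * m ^ n) ^ (s n)
        = D ^ (1 - s n) * (K ^ (s n) * m ^ ((n : ℝ) * s n)) := by
      intro n
      rw [Real.mul_rpow hK0.le (by positivity), Real.rpow_mul hm0.le, Real.rpow_natCast]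
    simp_rw [e]
    have t1 : Filter.Tendsto (fun n => D ^ (1 - s n)) Filter.atTop (nhds (D ^ (1 - 0 : ℝ))) :=
      tendsto_const_nhds.rpow (tendsto_const_nhds.sub hs) (Or.inl hD0.ne')
    have t2 : Filter.Tendsto (fun n => K ^ (s n)) Filter.atTop (nhds (K ^ (0 : ℝ))) :=
      tendsto_const_nhds.rpow hs (Or.inl hK0.ne')
    have t3 : Filter.Tendsto (fun n : ℕ => m ^ ((n : ℝ) * s n)) Filter.atTop (nhds (m ^ (0 : ℝ))) :=
      tendsto_const_nhds.rpow hns (Or.inl hm0.ne')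
    have := t1.mul (t2.mul t3)
    simpa using this
  refine ge_of_tendsto hlim ?_
  filter_upwards [hba.eventually_gt_atTop (max 0 t)] with n hn
  have hn0 : 0 < b n - a := (le_max_left _ _).trans_lt hn
  have hnt : t ≤ b n - a := (le_max_right _ _).trans hn.le
  refine three_lines hd hp ha hy (b₁ := b n) (by linarith) hy
    (fun q h1 h2 => (hC q h1 h2).trans hD.le) (hK n) (div_nonneg ht0 hn0.le)
    ((div_le_one hn0).2 hnt) p ?_ (by rw [hp2]; ring)
  have : s n * (b n - a) = t := div_mul_cancel₀ _ hn0.ne'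
  change p.1.im = (1 - s n) * a + s n * b n
  linarith

/-- The (squared) Petersson norm function. -/
noncomputable def Phi (h : ℂ × ℂ → ℂ) (k₁ k₂ : ℤ) (p : ℂ × ℂ) : ℝ :=
  ‖h p‖ ^ 2 * p.1.im ^ k₁ * p.2.im ^ k₂

lemma Phi_zpow {h : ℂ × ℂ → ℂ} {k₁ k₂ : ℤ} {l c : ℝ} (hl : 1 < l)
    (hu : ∀ p ∈ HH, ‖h ((l : ℂ) * p.1, ((l⁻¹ : ℝ) : ℂ) * p.2)‖ = c * ‖h p‖)
    (hcl : c ^ 2 * l ^ k₁ * (l⁻¹) ^ k₂ = 1) (n : ℤ) : ∀ p ∈ HH,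
    Phi h k₁ k₂ (((l ^ n : ℝ) : ℂ) * p.1, ((l ^ (-n) : ℝ) : ℂ) * p.2) = Phi h k₁ k₂ p := by
  have hl0 : 0 < l := by linarith
  have step : ∀ p ∈ HH, Phi h k₁ k₂ ((l : ℂ) * p.1, ((l⁻¹ : ℝ) : ℂ) * p.2) = Phi h k₁ k₂ p := by
    intro p hp
    unfold Phi
    rw [hu p hp]
    simp only [Complex.im_ofReal_mul]
    rw [mul_zpow, mul_zpow]
    linear_combination (‖h p‖ ^ 2 * p.1.im ^ k₁ * p.2.im ^ k₂) * hcl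
  have hmem : ∀ n : ℤ, ∀ p ∈ HH,
      (((l ^ n : ℝ) : ℂ) * p.1, ((l ^ (-n) : ℝ) : ℂ) * p.2) ∈ HH := by
    intro n p hp
    refine ⟨?_, ?_⟩
    · rw [Complex.im_ofReal_mul]; exact mul_pos (by positivity) hp.1
    · rw [Complex.im_ofReal_mul]; exact mul_pos (by positivity) hp.2
  have hne : (l : ℂ) ≠ 0 := by exact_mod_cast hl0.ne'
  have hs : ∀ n : ℤ, ∀ p ∈ HH,
      Phi h k₁ k₂ (((l ^ (n + 1) : ℝ) : ℂ) * p.1, ((l ^ (-(n + 1)) : ℝ) : ℂ) * p.2) =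
      Phi h k₁ k₂ (((l ^ n : ℝ) : ℂ) * p.1, ((l ^ (-n) : ℝ) : ℂ) * p.2) := by
    intro n p hp
    rw [← step _ (hmem n p hp)]
    congr 1
    apply Prod.ext
    · simp only
      rw [zpow_add₀ hl0.ne']; push_cast; rw [zpow_one]; ring
    · simp only
      rw [neg_add, zpow_add₀ hl0.ne', zpow_neg_one]; push_cast; ring
  intro p hp
  induction n with
  | zero => simp
  | succ n ih => rw [hs n p hp, ih]
  | pred n ih => 
    rw [← ih, ← hs (-(n : ℤ) - 1) p hp]
    norm_num

lemma siegel {h : ℂ × ℂ → ℂ} {R l c : ℝ} {k₁ k₂ : ℤ} (hk : k₁ ≤ 0)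
    (hd : DifferentiableOn ℂ h HH) (hp : PerProp h R)
    (hl : 1 < l) (hc : 0 < c)
    (hu : ∀ p ∈ HH, ‖h ((l : ℂ) * p.1, ((l⁻¹ : ℝ) : ℂ) * p.2)‖ = c * ‖h p‖)
    (hcl : c ^ 2 * l ^ k₁ * (l⁻¹) ^ k₂ = 1) {t : ℝ} (ht : 0 < t) :
    ∃ w ∈ HH, ∀ p ∈ HH, t ≤ p.1.im * p.2.im → Phi h k₁ k₂ p ≤ Phi h k₁ k₂ w := by
  have hl0 : 0 < l := by linarith
  set α := min 1 (t / l) with hα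
  set β := max l t with hβ
  have hα0 : 0 < α := by positivity
  have hcont : ContinuousOn (Phi h k₁ k₂) (box R α β) := by
    have hsub : box R α β ⊆ HH := box_subset hα0
    unfold Phi
    refine ((hd.continuousOn.mono hsub).norm.pow 2).mul ?_ |>.mul ?_
    · exact (Complex.continuous_im.comp continuous_fst).continuousOn.zpow₀ _
        (fun p hp => Or.inl (hsub hp).1.ne')
    · exact (Complex.continuous_im.comp continuous_snd).continuousOn.zpow₀ _
        (fun p hp => Or.inl (hsub hp).2.ne')
  have hR : 0 ≤ R := by
    obtain ⟨q, hq, -⟩ := hp (Complex.I, Complex.I) ⟨by simp, by simp⟩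
    exact (abs_nonneg _).trans hq
  have hne : (box R α β).Nonempty := by
    refine ⟨(⟨0, 1⟩, ⟨0, 1⟩), mem_box.2 ?_⟩
    have : (1 : ℝ) ∈ Set.Icc α β := ⟨min_le_left _ _, hl.le.trans (le_max_left _ _)⟩
    simp only [abs_zero]
    exact ⟨hR, this, hR, this⟩
  obtain ⟨w, hw, hmax⟩ := (isCompact_box R α β).exists_isMaxOn hne hcont
  have level : ∀ q ∈ HH, q.1.im * q.2.im = t → Phi h k₁ k₂ q ≤ Phi h k₁ k₂ w := by
    intro q hq hqt
    obtain ⟨n, hn1, hn2⟩ := exists_mem_Ico_zpow hq.2 hl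
    rw [← Phi_zpow hl hu hcl n q hq]
    set q' : ℂ × ℂ := (((l ^ n : ℝ) : ℂ) * q.1, ((l ^ (-n) : ℝ) : ℂ) * q.2) with hq'
    have i1 : q'.1.im = l ^ n * q.1.im := by rw [hq', Complex.im_ofReal_mul]
    have i2 : q'.2.im = l ^ (-n) * q.2.im := by rw [hq', Complex.im_ofReal_mul]
    have hln : 0 < l ^ n := by positivity
    have i3 : q'.1.im * q'.2.im = t := by
      rw [i1, i2, zpow_neg, ← hqt]; field_simp
    have i4 : 1 ≤ q'.2.im := by
      rw [i2, zpow_neg, ← div_eq_inv_mul, le_div_iff₀ hln]; simpa using hn1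
    have i5 : q'.2.im ≤ l := by
      rw [i2, zpow_neg, ← div_eq_inv_mul, div_le_iff₀ hln]
      rw [zpow_add_one₀ hl0.ne'] at hn2; linarith
    have i6 : 0 < q'.1.im := by rw [i1]; exact mul_pos hln hq.1
    have i7 : q'.1.im ≤ t := by nlinarith
    have i8 : t / l ≤ q'.1.im := by rw [div_le_iff₀ hl0]; nlinarith
    obtain ⟨r, r1, r2, r3, r4, r5⟩ := hp q' ⟨i6, by linarith⟩
    have : Phi h k₁ k₂ q' = Phi h k₁ k₂ r := by unfold Phi; rw [r3, r4, r5]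
    rw [this]
    apply hmax
    rw [mem_box, r3, r4]
    exact ⟨r1, ⟨(min_le_right _ _).trans i8, i7.trans (le_max_right _ _)⟩, r2,
      ⟨(min_le_left _ _).trans i4, i5.trans (le_max_left _ _)⟩⟩
  refine ⟨w, box_subset hα0 hw, fun p hpH hpt => ?_⟩
  set y := p.2.im with hy
  have hy0 : 0 < y := hpH.2
  set a := t / y with ha
  have ha0 : 0 < a := by positivity
  have hay : a * y = t := div_mul_cancel₀ _ hy0.ne'
  have hap : a ≤ p.1.im := by rw [ha, div_le_iff₀ hy0]; exact hpt
  set S := Phi h k₁ k₂ w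
  have hbd : ∀ q : ℂ × ℂ, q.1.im = a → q.2.im = y → ‖h q‖ ≤ √(S / (a ^ k₁ * y ^ k₂)) := by
    intro q h1 h2
    apply Real.le_sqrt_of_sq_le
    rw [le_div_iff₀ (by positivity)]
    have := level q ⟨by rw [h1]; exact ha0, by rw [h2]; exact hy0⟩ (by rw [h1, h2, hay])
    unfold Phi at this
    rw [h1, h2] at this
    linarith
  have hS0 : 0 ≤ S := by
    have := box_subset hα0 hw
    have h1 := this.1
    have h2 := this.2
    simp only [S, Phi]
    positivity
  have h1 := mono_first hd hp hl hc hu ha0 hy0 hbd p hap rfl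
  have h2 : ‖h p‖ ^ 2 ≤ S / (a ^ k₁ * y ^ k₂) := by
    have := pow_le_pow_left₀ (norm_nonneg _) h1 2
    rwa [Real.sq_sqrt (by positivity)] at this
  rw [le_div_iff₀ (by positivity)] at h2
  have h3 : p.1.im ^ k₁ ≤ a ^ k₁ := by
    obtain ⟨m, hm⟩ : ∃ m : ℕ, k₁ = -(m : ℤ) := ⟨(-k₁).toNat, by omega⟩
    rw [hm, zpow_neg, zpow_neg, zpow_natCast, zpow_natCast]
    gcongr
  unfold Phi
  have h4 : 0 < y ^ k₂ := by positivity
  calc ‖h p‖ ^ 2 * p.1.im ^ k₁ * p.2.im ^ k₂ ≤ ‖h p‖ ^ 2 * a ^ k₁ * y ^ k₂ := by gcongr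
    _ ≤ S := by linarith

lemma max_concl {f : ℂ × ℂ → ℂ} {k₁ k₂ : ℤ} (hk : k₁ ≤ 0) (hd : DifferentiableOn ℂ f HH)
    {w : ℂ × ℂ} (hw : w ∈ HH) (hmax : ∀ p ∈ HH, Phi f k₁ k₂ p ≤ Phi f k₁ k₂ w) :
    (k₁ < 0 → ∀ p ∈ HH, f p = 0) ∧ (k₁ = 0 → ∀ z : ℂ, 0 < z.im → f (z, w.2) = f w) := by
  set a := w.1.im with ha
  have ha0 : 0 < a := hw.1
  have hy0 : 0 < w.2.im := hw.2
  let g : ℂ → ℂ := fun z => f (z, w.2) * (z - (starRingEnd ℂ) w.1) ^ k₁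
  let U : Set ℂ := {z | 0 < z.im}
  have hUo : IsOpen U := isOpen_lt continuous_const Complex.continuous_im
  have hUc : IsPreconnected U := (convex_halfSpace_im_gt 0).isPreconnected
  have hzne : ∀ z ∈ U, z - (starRingEnd ℂ) w.1 ≠ 0 := by
    intro z hz h0
    have := congrArg Complex.im h0
    simp at this
    have hz : 0 < z.im := hz
    linarith
  have hslice : DifferentiableOn ℂ (fun z => f (z, w.2)) U := by
    apply hd.comp (f := fun z : ℂ => (z, w.2))
    · exact (differentiable_id.prodMk (differentiable_const _)).differentiableOn
    · intro z hz; exact ⟨hz, hy0⟩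
  have hgd : DifferentiableOn ℂ g U := by
    apply hslice.mul
    intro z hz
    apply DifferentiableAt.differentiableWithinAt
    exact (differentiableAt_id.sub_const _).zpow (Or.inl (hzne z hz))
  have hnorm : ∀ z : ℂ, ‖z - (starRingEnd ℂ) w.1‖ ^ 2 = ‖z - w.1‖ ^ 2 + 4 * z.im * a := by
    intro z
    rw [← Complex.normSq_eq_norm_sq, ← Complex.normSq_eq_norm_sq, Complex.normSq_apply,
      Complex.normSq_apply]
    simp [ha]; ring
  have hbase : ∀ z ∈ U, ‖f (z, w.2)‖ ^ 2 * z.im ^ k₁ ≤ ‖f w‖ ^ 2 * a ^ k₁ := by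
    intro z hz
    have := hmax (z, w.2) ⟨hz, hy0⟩
    unfold Phi at this
    simp only at this
    exact le_of_mul_le_mul_right this (by positivity)
  obtain ⟨m, hm⟩ : ∃ m : ℕ, k₁ = -(m : ℤ) := ⟨(-k₁).toNat, by omega⟩
  have hbase2 : ∀ z ∈ U, ‖f (z, w.2)‖ ^ 2 * a ^ m ≤ ‖f w‖ ^ 2 * z.im ^ m := by
    intro z hz
    have hz0 : 0 < z.im := hz
    have := hbase z hz
    rw [hm, zpow_neg, zpow_neg, zpow_natCast, zpow_natCast, ← div_eq_mul_inv, ← div_eq_mul_inv,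
      div_le_div_iff₀ (by positivity) (by positivity)] at this
    exact this
  have hgn : ∀ z ∈ U, ‖g z‖ ^ 2 * (‖z - w.1‖ ^ 2 + 4 * z.im * a) ^ m = ‖f (z, w.2)‖ ^ 2 := by
    intro z hz
    have h0 : ‖z - (starRingEnd ℂ) w.1‖ ≠ 0 := norm_ne_zero_iff.2 (hzne z hz)
    rw [← hnorm]
    simp only [g]
    rw [norm_mul, norm_zpow, hm, zpow_neg, zpow_natCast]
    field_simp
    ring
  have hwU : w.1 ∈ U := ha0
  have hgw : ‖g w.1‖ ^ 2 * (4 * a * a) ^ m = ‖f w‖ ^ 2 := by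
    have := hgn w.1 hwU
    simpa using this
  have hkey : ∀ z ∈ U, ‖g z‖ ^ 2 * (‖z - w.1‖ ^ 2 + 4 * z.im * a) ^ m ≤
      ‖g w.1‖ ^ 2 * (4 * z.im * a) ^ m := by
    intro z hz
    rw [hgn z hz]
    have := hbase2 z hz
    rw [← hgw] at this
    have e : ‖g w.1‖ ^ 2 * (4 * a * a) ^ m * z.im ^ m = ‖g w.1‖ ^ 2 * (4 * z.im * a) ^ m * a ^ m := by
      simp only [mul_pow]; ring
    rw [e] at this
    exact le_of_mul_le_mul_right this (by positivity)
  have hismax : IsMaxOn (norm ∘ g) U w.1 := by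
    intro z hz
    have hz0 : 0 < z.im := hz
    have h1 := hkey z hz
    have h2 : ‖g z‖ ^ 2 * (4 * z.im * a) ^ m ≤ ‖g w.1‖ ^ 2 * (4 * z.im * a) ^ m := by
      refine le_trans ?_ h1
      gcongr
      nlinarith [sq_nonneg ‖z - w.1‖]
    have h3 := le_of_mul_le_mul_right h2 (by positivity)
    exact (sq_le_sq₀ (norm_nonneg _) (norm_nonneg _)).1 h3
  have heq := Complex.eqOn_of_isPreconnected_of_isMaxOn_norm hUc hUo hgd hwU hismax
  constructor
  · intro hk0
    have hm0 : m ≠ 0 := by rintro rfl; simp at hm; omega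
    have hz : w.1 + 1 ∈ U := by change 0 < (w.1 + 1).im; simpa using ha0
    have h1 := hkey _ hz
    rw [heq hz] at h1
    simp only [Function.const_apply, add_sub_cancel_left, norm_one, Complex.add_im, Complex.one_im,
      add_zero] at h1
    have hlt : (4 * a * a) ^ m < (1 ^ 2 + 4 * a * a) ^ m := by
      apply pow_lt_pow_left₀ (by linarith) (by positivity) hm0
    have hg0 : ‖g w.1‖ ^ 2 = 0 := by
      by_contra hne
      have : 0 < ‖g w.1‖ ^ 2 := lt_of_le_of_ne (by positivity) (Ne.symm hne)
      have := mul_lt_mul_of_pos_left hlt this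
      linarith
    have hfw : ‖f w‖ ^ 2 = 0 := by rw [← hgw, hg0, zero_mul]
    intro p hp
    have h1p := hp.1
    have h2p := hp.2
    have := hmax p hp
    unfold Phi at this
    rw [hfw, zero_mul, zero_mul] at this
    have h5 : ‖f p‖ ^ 2 ≤ 0 := by
      rw [mul_assoc] at this
      exact nonpos_of_mul_nonpos_left this (by positivity)
    have h6 : ‖f p‖ = 0 := by nlinarith [norm_nonneg (f p)]
    exact norm_eq_zero.1 h6
  · intro hk0 z hz
    have := heq (show z ∈ U from hz)
    simpa [g, hk0] using this

open Matrix in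
/-- Automorphy factor. -/
noncomputable def den (A : SpecialLinearGroup (Fin 2) ℝ) (z : ℂ) : ℂ :=
  (A 1 0 : ℂ) * z + (A 1 1 : ℂ)

open Matrix in
/-- Moebius action. -/
noncomputable def mob (A : SpecialLinearGroup (Fin 2) ℝ) (z : ℂ) : ℂ :=
  ((A 0 0 : ℂ) * z + (A 0 1 : ℂ)) / den A z

lemma sl_det {R : Type*} [CommRing R] (A : Matrix.SpecialLinearGroup (Fin 2) R) :
    A 0 0 * A 1 1 - A 0 1 * A 1 0 = 1 := by
  rw [← Matrix.det_fin_two]; exact A.2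

lemma den_ne (A : Matrix.SpecialLinearGroup (Fin 2) ℝ) {z : ℂ} (hz : 0 < z.im) : den A z ≠ 0 := by
  intro h
  have h1 := congrArg Complex.im h
  have h2 := congrArg Complex.re h
  simp [den] at h1 h2
  have hd := sl_det A
  rcases h1 with h1 | h1
  · rw [h1] at h2 hd
    simp at h2
    rw [h2] at hd
    simp at hd
  · exact hz.ne' h1

lemma im_mob (A : Matrix.SpecialLinearGroup (Fin 2) ℝ) {z : ℂ} (hz : 0 < z.im) :
    (mob A z).im = z.im / ‖den A z‖ ^ 2 := by
  have h0 := den_ne A hz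
  have hn : Complex.normSq (den A z) ≠ 0 := by simpa using h0
  rw [mob, Complex.div_im, ← Complex.normSq_eq_norm_sq]
  have hd := sl_det A
  field_simp
  simp [den]
  linear_combination z.im * hd

lemma im_mob_pos (A : Matrix.SpecialLinearGroup (Fin 2) ℝ) {z : ℂ} (hz : 0 < z.im) :
    0 < (mob A z).im := by
  rw [im_mob A hz]
  have := norm_pos_iff.2 (den_ne A hz)
  positivity

lemma den_mul (A B : Matrix.SpecialLinearGroup (Fin 2) ℝ) {z : ℂ} (hz : 0 < z.im) :
    den (A * B) z = den A (mob B z) * den B z := by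
  have h0 := den_ne B hz
  rw [den, den, mob]
  field_simp
  rw [den]
  simp [Matrix.mul_apply, Fin.sum_univ_two]
  ring

lemma mob_mul (A B : Matrix.SpecialLinearGroup (Fin 2) ℝ) {z : ℂ} (hz : 0 < z.im) :
    mob (A * B) z = mob A (mob B z) := by
  have h0 := den_ne B hz
  have h1 := den_ne A (im_mob_pos B hz)
  have h2 := den_mul A B hz
  have h3 : ((A 0 0 : ℂ) * mob B z + (A 0 1 : ℂ)) * den B z =
      (((A * B) 0 0 : ℝ) : ℂ) * z + (((A * B) 0 1 : ℝ) : ℂ) := by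
    rw [mob]
    field_simp
    rw [den]
    simp [Matrix.mul_apply, Fin.sum_univ_two]
    ring
  conv_lhs => rw [mob]
  conv_rhs => rw [mob]
  rw [h2, ← h3]
  field_simp

lemma mob_one (z : ℂ) : mob 1 z = z := by simp [mob, den]

lemma differentiableAt_den (A : Matrix.SpecialLinearGroup (Fin 2) ℝ) (z : ℂ) :
    DifferentiableAt ℂ (den A) z := by
  unfold den; fun_prop

lemma differentiableAt_mob (A : Matrix.SpecialLinearGroup (Fin 2) ℝ) {z : ℂ} (hz : 0 < z.im) :
    DifferentiableAt ℂ (mob A) z := by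
  unfold mob
  apply DifferentiableAt.div
  · fun_prop
  · exact differentiableAt_den A z
  · exact den_ne A hz

section slash

variable {F : Type*} [Field F]

/-- Action of `SL₂(F)` on `ℍ × ℍ`. -/
noncomputable def act (σ σ' : F →+* ℝ) (A : Matrix.SpecialLinearGroup (Fin 2) F) (p : ℂ × ℂ) :
    ℂ × ℂ :=
  (mob (Matrix.SpecialLinearGroup.map σ A) p.1, mob (Matrix.SpecialLinearGroup.map σ' A) p.2)

/-- Automorphy factor of weight `(k₁, k₂)`. -/
noncomputable def autf (σ σ' : F →+* ℝ) (k₁ k₂ : ℤ) (A : Matrix.SpecialLinearGroup (Fin 2) F)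
    (p : ℂ × ℂ) : ℂ :=
  den (Matrix.SpecialLinearGroup.map σ A) p.1 ^ k₁ *
    den (Matrix.SpecialLinearGroup.map σ' A) p.2 ^ k₂

/-- Slash operator. -/
noncomputable def slash (σ σ' : F →+* ℝ) (k₁ k₂ : ℤ) (f : ℂ × ℂ → ℂ)
    (A : Matrix.SpecialLinearGroup (Fin 2) F) (p : ℂ × ℂ) : ℂ :=
  f (act σ σ' A p) * (autf σ σ' k₁ k₂ A p)⁻¹

variable (σ σ' : F →+* ℝ) (k₁ k₂ : ℤ)

lemma act_mem (A : Matrix.SpecialLinearGroup (Fin 2) F) {p : ℂ × ℂ} (hp : p ∈ HH) :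
    act σ σ' A p ∈ HH :=
  ⟨im_mob_pos _ hp.1, im_mob_pos _ hp.2⟩

lemma act_mul (A B : Matrix.SpecialLinearGroup (Fin 2) F) {p : ℂ × ℂ} (hp : p ∈ HH) :
    act σ σ' (A * B) p = act σ σ' A (act σ σ' B p) := by
  simp only [act, map_mul]
  rw [mob_mul _ _ hp.1, mob_mul _ _ hp.2]

lemma act_one (p : ℂ × ℂ) : act σ σ' (1 : Matrix.SpecialLinearGroup (Fin 2) F) p = p := by
  simp [act, mob_one]

lemma autf_ne (A : Matrix.SpecialLinearGroup (Fin 2) F) {p : ℂ × ℂ} (hp : p ∈ HH) :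
    autf σ σ' k₁ k₂ A p ≠ 0 :=
  mul_ne_zero (zpow_ne_zero _ (den_ne _ hp.1)) (zpow_ne_zero _ (den_ne _ hp.2))

lemma autf_mul (A B : Matrix.SpecialLinearGroup (Fin 2) F) {p : ℂ × ℂ} (hp : p ∈ HH) :
    autf σ σ' k₁ k₂ (A * B) p = autf σ σ' k₁ k₂ A (act σ σ' B p) * autf σ σ' k₁ k₂ B p := by
  simp only [autf, act, map_mul]
  rw [den_mul _ _ hp.1, den_mul _ _ hp.2, mul_zpow, mul_zpow]
  ring

lemma Phi_transform (f h : ℂ × ℂ → ℂ) (A : Matrix.SpecialLinearGroup (Fin 2) F) {p : ℂ × ℂ}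
    (hp : p ∈ HH) (hf : f (act σ σ' A p) = autf σ σ' k₁ k₂ A p * h p) :
    Phi f k₁ k₂ (act σ σ' A p) = Phi h k₁ k₂ p := by
  unfold Phi
  rw [hf]
  simp only [autf, act]
  rw [im_mob _ hp.1, im_mob _ hp.2]
  have h1 := norm_pos_iff.2 (den_ne (Matrix.SpecialLinearGroup.map σ A) hp.1)
  have h2 := norm_pos_iff.2 (den_ne (Matrix.SpecialLinearGroup.map σ' A) hp.2)
  rw [norm_mul, norm_mul, norm_zpow, norm_zpow, div_zpow, div_zpow]
  set a := ‖den (Matrix.SpecialLinearGroup.map σ A) p.1‖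
  set b := ‖den (Matrix.SpecialLinearGroup.map σ' A) p.2‖
  have e1 : (a ^ 2) ^ k₁ = (a ^ k₁) ^ 2 := by
    rw [← zpow_natCast, ← zpow_natCast, ← zpow_mul, ← zpow_mul, mul_comm]
  have e2 : (b ^ 2) ^ k₂ = (b ^ k₂) ^ 2 := by
    rw [← zpow_natCast, ← zpow_natCast, ← zpow_mul, ← zpow_mul, mul_comm]
  rw [e1, e2]
  have := zpow_ne_zero k₁ h1.ne'
  have := zpow_ne_zero k₂ h2.ne'
  field_simp

lemma Phi_slash (f : ℂ × ℂ → ℂ) (A : Matrix.SpecialLinearGroup (Fin 2) F) {p : ℂ × ℂ}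
    (hp : p ∈ HH) : Phi f k₁ k₂ (act σ σ' A p) = Phi (slash σ σ' k₁ k₂ f A) k₁ k₂ p := by
  apply Phi_transform _ _ _ _ _ _ _ hp
  have := autf_ne σ σ' k₁ k₂ A hp
  rw [slash]
  field_simp

lemma differentiableOn_slash {f : ℂ × ℂ → ℂ} (hf : DifferentiableOn ℂ f HH)
    (A : Matrix.SpecialLinearGroup (Fin 2) F) :
    DifferentiableOn ℂ (slash σ σ' k₁ k₂ f A) HH := by
  intro p hp
  apply DifferentiableAt.differentiableWithinAt
  have hfd : DifferentiableAt ℂ f (act σ σ' A p) :=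
    hf.differentiableAt (isOpen_HH.mem_nhds (act_mem σ σ' A hp))
  have hm : DifferentiableAt ℂ (act σ σ' A) p := by
    unfold act
    exact ((differentiableAt_mob _ hp.1).comp p differentiableAt_fst).prodMk
      ((differentiableAt_mob _ hp.2).comp p differentiableAt_snd)
  have ha : DifferentiableAt ℂ (autf σ σ' k₁ k₂ A) p := by
    unfold autf
    apply DifferentiableAt.mul
    · exact (((differentiableAt_den _ _).comp p differentiableAt_fst)).zpow
        (Or.inl (den_ne _ hp.1))
    · exact (((differentiableAt_den _ _).comp p differentiableAt_snd)).zpow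
        (Or.inl (den_ne _ hp.2))
  exact (hfd.comp p hm).mul (ha.inv (autf_ne σ σ' k₁ k₂ A hp))

/-- Invariance of the slash under conjugated elements. -/
lemma slash_inv {f : ℂ × ℂ → ℂ} (A B G : Matrix.SpecialLinearGroup (Fin 2) F)
    (hG : ∀ p ∈ HH, f (act σ σ' G p) = autf σ σ' k₁ k₂ G p * f p) (hAB : G * A = A * B)
    {p : ℂ × ℂ} (hp : p ∈ HH) :
    slash σ σ' k₁ k₂ f A (act σ σ' B p) = autf σ σ' k₁ k₂ B p * slash σ σ' k₁ k₂ f A p := by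
  have h1 := autf_ne σ σ' k₁ k₂ A hp
  have h2 := autf_ne σ σ' k₁ k₂ A (act_mem σ σ' B hp)
  have h3 := autf_ne σ σ' k₁ k₂ B hp
  have e1 := autf_mul σ σ' k₁ k₂ A B hp
  have e2 := autf_mul σ σ' k₁ k₂ G A hp
  rw [hAB, e1] at e2
  rw [slash, slash, ← act_mul _ _ _ _ hp, ← hAB, act_mul _ _ _ _ hp, hG _ (act_mem σ σ' A hp)]
  field_simp
  linear_combination (-f (act σ σ' A p)) * e2

end slash

section arith

open NumberField

variable {F : Type*} [Field F] [NumberField F]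

/-- `SL₂(𝒪_F) → SL₂(F)`. -/
noncomputable def toF (γ : Matrix.SpecialLinearGroup (Fin 2) (𝓞 F)) :
    Matrix.SpecialLinearGroup (Fin 2) F :=
  Matrix.SpecialLinearGroup.map (algebraMap (𝓞 F) F) γ

lemma exists_denom (A : Matrix.SpecialLinearGroup (Fin 2) F) :
    ∃ N : ℤ, 0 < N ∧ ∀ i j k l, IsIntegral ℤ ((N : F) * (A i j * A k l)) := by
  classical
  obtain ⟨y, hy0, hy⟩ := exists_integral_multiples ℤ ℚ
    (Finset.univ.image (fun ij : Fin 2 × Fin 2 => A ij.1 ij.2))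
  refine ⟨y ^ 2, by positivity, fun i j k l => ?_⟩
  have h1 := hy (A i j) (Finset.mem_image.2 ⟨(i, j), Finset.mem_univ _, rfl⟩)
  have h2 := hy (A k l) (Finset.mem_image.2 ⟨(k, l), Finset.mem_univ _, rfl⟩)
  have h3 := h1.mul h2
  have h4 : ((y ^ 2 : ℤ) : F) * (A i j * A k l) = (y • A i j) * (y • A k l) := by
    rw [zsmul_eq_mul, zsmul_eq_mul]
    push_cast
    ring
  rw [h4]
  exact h3

/-- Conjugating a matrix congruent to `1` modulo the denominator gives an integral matrix. -/
lemma exists_conj (A : Matrix.SpecialLinearGroup (Fin 2) F) {N : ℤ}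
    (hN : ∀ i j k l, IsIntegral ℤ ((N : F) * (A i j * A k l)))
    (B : Matrix.SpecialLinearGroup (Fin 2) F) (c : Fin 2 → Fin 2 → 𝓞 F)
    (hB : ∀ i j, B i j = (if i = j then 1 else 0) + (N : F) * (c i j : F)) :
    ∃ γ : Matrix.SpecialLinearGroup (Fin 2) (𝓞 F), toF γ * A = A * B := by
  have hIntl : ∀ i j, IsIntegral ℤ ((A * B * A⁻¹) i j) := by
    have hc : ∀ i j, IsIntegral ℤ ((c i j : F)) := fun i j => (c i j).2
    have hd := sl_det A
    have e00 : (A * B * A⁻¹) 0 0 = 1 + (N * (A 0 0 * A 1 1) * c 0 0 + N * (A 0 1 * A 1 1) * c 1 0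
        - N * (A 0 0 * A 1 0) * c 0 1 - N * (A 0 1 * A 1 0) * c 1 1) := by
      simp [Matrix.SpecialLinearGroup.coe_inv, Matrix.adjugate_fin_two, Matrix.mul_apply,
        Fin.sum_univ_two, hB]
      linear_combination hd
    have e01 : (A * B * A⁻¹) 0 1 = (-(N * (A 0 0 * A 0 1) * c 0 0) - N * (A 0 1 * A 0 1) * c 1 0
        + N * (A 0 0 * A 0 0) * c 0 1 + N * (A 0 1 * A 0 0) * c 1 1) := by
      simp [Matrix.SpecialLinearGroup.coe_inv, Matrix.adjugate_fin_two, Matrix.mul_apply,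
        Fin.sum_univ_two, hB]
      ring
    have e10 : (A * B * A⁻¹) 1 0 = (N * (A 1 0 * A 1 1) * c 0 0 + N * (A 1 1 * A 1 1) * c 1 0
        - N * (A 1 0 * A 1 0) * c 0 1 - N * (A 1 1 * A 1 0) * c 1 1) := by
      simp [Matrix.SpecialLinearGroup.coe_inv, Matrix.adjugate_fin_two, Matrix.mul_apply,
        Fin.sum_univ_two, hB]
      ring
    have e11 : (A * B * A⁻¹) 1 1 = 1 + (-(N * (A 1 0 * A 0 1) * c 0 0) - N * (A 1 1 * A 0 1) * c 1 0
        + N * (A 1 0 * A 0 0) * c 0 1 + N * (A 1 1 * A 0 0) * c 1 1) := by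
      simp [Matrix.SpecialLinearGroup.coe_inv, Matrix.adjugate_fin_two, Matrix.mul_apply,
        Fin.sum_univ_two, hB]
      linear_combination hd
    have t : ∀ i j k l m n, IsIntegral ℤ ((N : F) * (A i j * A k l) * (c m n : F)) :=
      fun i j k l m n => (hN i j k l).mul (hc m n)
    intro i j
    fin_cases i <;> fin_cases j
    · exact e00 ▸ isIntegral_one.add ((((t _ _ _ _ _ _).add (t _ _ _ _ _ _)).sub
        (t _ _ _ _ _ _)).sub (t _ _ _ _ _ _))
    · exact e01 ▸ ((((t _ _ _ _ _ _).neg.sub (t _ _ _ _ _ _)).add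
        (t _ _ _ _ _ _)).add (t _ _ _ _ _ _))
    · exact e10 ▸ ((((t _ _ _ _ _ _).add (t _ _ _ _ _ _)).sub
        (t _ _ _ _ _ _)).sub (t _ _ _ _ _ _))
    · exact e11 ▸ isIntegral_one.add ((((t _ _ _ _ _ _).neg.sub (t _ _ _ _ _ _)).add
        (t _ _ _ _ _ _)).add (t _ _ _ _ _ _))
  let g : Matrix (Fin 2) (Fin 2) (𝓞 F) := fun i j => ⟨(A * B * A⁻¹) i j, hIntl i j⟩
  have hg : ∀ i j, ((g i j : 𝓞 F) : F) = (A * B * A⁻¹) i j := fun i j => rfl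
  have hdet : g.det = 1 := by
    apply RingOfIntegers.coe_injective
    rw [Matrix.det_fin_two]
    simp only [map_sub, map_mul, map_one]
    exact sl_det (A * B * A⁻¹)
  refine ⟨⟨g, hdet⟩, ?_⟩
  have : toF ⟨g, hdet⟩ = A * B * A⁻¹ := by
    ext i j
    exact hg i j
  rw [this]
  group

end arith

section cusp

open NumberField

variable {F : Type*} [Field F] [NumberField F]

/-- upper triangular matrix with given diagonal. -/
def upperTri (a b c : F) (h : a * c = 1) : Matrix.SpecialLinearGroup (Fin 2) F :=
  ⟨!![a, b; 0, c], by simp [Matrix.det_fin_two, h]⟩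

lemma map_ent (σ : F →+* ℝ) (A : Matrix.SpecialLinearGroup (Fin 2) F) (i j : Fin 2) :
    (Matrix.SpecialLinearGroup.map σ A) i j = σ (A i j) := rfl

lemma act_upperTri (σ σ' : F →+* ℝ) (a b c : F) (h : a * c = 1) (p : ℂ × ℂ) :
    act σ σ' (upperTri a b c h) p =
      (((σ a : ℂ) * p.1 + (σ b : ℂ)) / (σ c : ℂ), ((σ' a : ℂ) * p.2 + (σ' b : ℂ)) / (σ' c : ℂ)) := by
  simp only [act, mob, den, map_ent]
  simp [upperTri]

lemma autf_upperTri (σ σ' : F →+* ℝ) (k₁ k₂ : ℤ) (a b c : F) (h : a * c = 1) (p : ℂ × ℂ) :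
    autf σ σ' k₁ k₂ (upperTri a b c h) p = (σ c : ℂ) ^ k₁ * (σ' c : ℂ) ^ k₂ := by
  simp only [autf, den, map_ent]
  simp [upperTri]

lemma per_slash (σ σ' : F →+* ℝ) (k₁ k₂ : ℤ) (r : 𝓞 F) {s : ℝ} (hs0 : s ≠ 0)
    (hσ : σ (r : F) = s) (hσ' : σ' (r : F) = -s)
    {f : ℂ × ℂ → ℂ}
    (hmod : ∀ γ : Matrix.SpecialLinearGroup (Fin 2) (𝓞 F), ∀ p ∈ HH,
      f (act σ σ' (toF γ) p) = autf σ σ' k₁ k₂ (toF γ) p * f p)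
    (A : Matrix.SpecialLinearGroup (Fin 2) F) {N : ℤ} (hN0 : 0 < N)
    (hN : ∀ i j k l, IsIntegral ℤ ((N : F) * (A i j * A k l))) :
    PerProp (slash σ σ' k₁ k₂ f A) (N * (1 + |s|)) := by
  intro p hp
  have hNr : (0 : ℝ) < N := by exact_mod_cast hN0
  set α : ℝ := (p.1.re + p.2.re) / (2 * N) with hα
  set β : ℝ := (p.1.re - p.2.re) / (2 * N * s) with hβ
  have hu : p.1.re = N * (α + s * β) := by rw [hα, hβ]; field_simp; ring
  have hv : p.2.re = N * (α - s * β) := by rw [hα, hβ]; field_simp; ring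
  let x : 𝓞 F := -((⌊α⌋ : ℤ) : 𝓞 F) - ((⌊β⌋ : ℤ) : 𝓞 F) * r
  have hx : (x : F) = -((⌊α⌋ : ℤ) : F) - ((⌊β⌋ : ℤ) : F) * r := by simp [x]
  let B := upperTri (1 : F) ((N : F) * (x : F)) 1 (by ring)
  obtain ⟨γ, hγ⟩ := exists_conj A hN B (fun i j => if i = 0 ∧ j = 1 then x else 0) (by
    intro i j
    fin_cases i <;> fin_cases j <;> simp [B, upperTri])
  have key := slash_inv σ σ' k₁ k₂ A B (toF γ) (hmod γ) hγ hp
  rw [autf_upperTri, act_upperTri] at key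
  simp only [map_one, Complex.ofReal_one, one_zpow, one_mul, div_one] at key
  refine ⟨_, ?_, ?_, ?_, ?_, key⟩
  · simp only [Complex.add_re, Complex.ofReal_re, map_mul, map_intCast, hx, map_sub, map_neg, hσ]
    have e : p.1.re + N * (-(⌊α⌋ : ℝ) - ⌊β⌋ * s) = N * (Int.fract α + s * Int.fract β) := by
      rw [hu, Int.fract, Int.fract]; ring
    rw [e, abs_mul, abs_of_pos hNr]
    gcongr
    refine (abs_add_le _ _).trans ?_
    rw [abs_mul, Int.abs_fract, Int.abs_fract]
    have := Int.fract_lt_one α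
    have := Int.fract_lt_one β
    have := Int.fract_nonneg β
    nlinarith [abs_nonneg s]
  · simp only [Complex.add_re, Complex.ofReal_re, map_mul, map_intCast, hx, map_sub, map_neg, hσ']
    have e : p.2.re + N * (-(⌊α⌋ : ℝ) - ⌊β⌋ * -s) = N * (Int.fract α + (-s) * Int.fract β) := by
      rw [hv, Int.fract, Int.fract]; ring
    rw [e, abs_mul, abs_of_pos hNr]
    gcongr
    refine (abs_add_le _ _).trans ?_
    rw [abs_mul, Int.abs_fract, Int.abs_fract, abs_neg]
    have := Int.fract_lt_one α
    have := Int.fract_lt_one β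
    have := Int.fract_nonneg β
    nlinarith [abs_nonneg s]
  · simp
  · simp

/-- A unit congruent to one modulo `N`. -/
lemma exists_unit (σ σ' : F →+* ℝ) (r : 𝓞 F) {s : ℝ} (hs0 : s ≠ 0)
    (hσ : σ (r : F) = s) (hσ' : σ' (r : F) = -s) {d : ℤ} (hd : 1 < d) (hsq : ¬ IsSquare d)
    (hr : (r : F) ^ 2 = d) {N : ℤ} (hN0 : 0 < N) :
    ∃ (u v : 𝓞 F) (e : ℝ), 1 < e ∧ (1 + (N : F) * u) * (1 + (N : F) * v) = 1 ∧
      σ (1 + (N : F) * u) = e ∧ σ' (1 + (N : F) * u) = e⁻¹ ∧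
      σ (1 + (N : F) * v) = e⁻¹ ∧ σ' (1 + (N : F) * v) = e := by
  have hsq2 : ¬ IsSquare (d * N ^ 2) := by
    rintro ⟨m, hm⟩
    have hdvd : N ∣ m := by
      rw [← Int.pow_dvd_pow_iff (n := 2) two_ne_zero]
      exact ⟨d, by rw [pow_two m, ← hm]; ring⟩
    obtain ⟨q, rfl⟩ := hdvd
    apply hsq
    refine ⟨q, ?_⟩
    have : N ^ 2 ≠ 0 := by positivity
    apply mul_right_cancel₀ this
    rw [hm]; ring
  obtain ⟨x₀, y₀, h₀, hy₀⟩ := Pell.exists_of_not_isSquare (d := d * N ^ 2) (by positivity) hsq2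
  have hNr : (0 : ℝ) < N := by exact_mod_cast hN0
  obtain ⟨x, y, hxy, hx, hy⟩ : ∃ x y : ℤ, x ^ 2 - d * N ^ 2 * y ^ 2 = 1 ∧ 1 ≤ x ∧
      0 < (y : ℝ) * N * s := by
    have hx0 : x₀ ≠ 0 := by
      rintro rfl
      have : 0 ≤ d * N ^ 2 * y₀ ^ 2 := by positivity
      nlinarith
    have hx1 : 1 ≤ |x₀| := Int.one_le_abs hx0
    rcases lt_or_gt_of_ne (show (y₀ : ℝ) * N * s ≠ 0 from
      mul_ne_zero (mul_ne_zero (by exact_mod_cast hy₀) hNr.ne') hs0) with h | h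
    · exact ⟨|x₀|, -y₀, by rw [sq_abs, neg_sq]; exact h₀, hx1, by push_cast; nlinarith⟩
    · exact ⟨|x₀|, y₀, by rw [sq_abs]; exact h₀, hx1, h⟩
  have hxyF : (x : F) ^ 2 - d * N ^ 2 * y ^ 2 = 1 := by exact_mod_cast congrArg (Int.cast : ℤ → F) hxy
  have hxyR : (x : ℝ) ^ 2 - d * N ^ 2 * y ^ 2 = 1 := by
    exact_mod_cast congrArg (Int.cast : ℤ → ℝ) hxy
  have hs2 : s ^ 2 = d := by rw [← hσ, ← map_pow, hr, map_intCast]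
  have hxr : (1 : ℝ) ≤ x := by exact_mod_cast hx
  have hprod : (x + y * N * s) ^ 2 * (x - y * N * s) ^ 2 = (1 : ℝ) := by
    have : (x + y * N * s) * (x - y * N * s) = (1 : ℝ) := by
      rw [← hxyR, ← hs2]; ring
    rw [← mul_pow, this, one_pow]
  have hinv : ((x : ℝ) - y * N * s) ^ 2 = ((x + y * N * s) ^ 2)⁻¹ := by
    exact eq_inv_of_mul_eq_one_right hprod
  let u : 𝓞 F := ((2 : ℤ) : 𝓞 F) * d * N * y ^ 2 + ((2 : ℤ) : 𝓞 F) * x * y * r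
  let v : 𝓞 F := ((2 : ℤ) : 𝓞 F) * d * N * y ^ 2 - ((2 : ℤ) : 𝓞 F) * x * y * r
  have hu : (u : F) = 2 * d * N * y ^ 2 + 2 * x * y * r := by
    simp only [u, map_add, map_mul, map_pow, map_intCast]
    norm_cast
  have hv : (v : F) = 2 * d * N * y ^ 2 - 2 * x * y * r := by
    simp only [v, map_sub, map_mul, map_pow, map_intCast]
    norm_cast
  have hu' : 1 + (N : F) * u = (x + y * N * r) ^ 2 := by
    rw [hu]; linear_combination (-1) * hxyF - (y : F) ^ 2 * N ^ 2 * hr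
  have hv' : 1 + (N : F) * v = (x - y * N * r) ^ 2 := by
    rw [hv]; linear_combination (-1) * hxyF - (y : F) ^ 2 * N ^ 2 * hr
  refine ⟨u, v, (x + y * N * s) ^ 2, ?_, ?_, ?_, ?_, ?_, ?_⟩
  · nlinarith
  · rw [hu', hv', ← mul_pow]
    have : ((x : F) + y * N * r) * (x - y * N * r) = 1 := by
      linear_combination hxyF - (y : F) ^ 2 * N ^ 2 * hr
    rw [this, one_pow]
  · rw [hu']; simp [hσ]
  · rw [hu', ← hinv]; simp [hσ']; ring
  · rw [hv', ← hinv]; simp [hσ]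
  · rw [hv']; simp [hσ']

lemma cusp_bound (σ σ' : F →+* ℝ) {k₁ k₂ : ℤ} (hk : k₁ ≤ 0) (r : 𝓞 F) {s : ℝ} (hs0 : s ≠ 0)
    (hσ : σ (r : F) = s) (hσ' : σ' (r : F) = -s) {d : ℤ} (hd : 1 < d) (hsq : ¬ IsSquare d)
    (hr : (r : F) ^ 2 = d) {f : ℂ × ℂ → ℂ} (hf : DifferentiableOn ℂ f HH)
    (hmod : ∀ γ : Matrix.SpecialLinearGroup (Fin 2) (𝓞 F), ∀ p ∈ HH,
      f (act σ σ' (toF γ) p) = autf σ σ' k₁ k₂ (toF γ) p * f p)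
    (A₀ : Matrix.SpecialLinearGroup (Fin 2) F) {t : ℝ} (ht : 0 < t) :
    ∃ w ∈ HH, ∀ p ∈ HH, t ≤ (act σ σ' A₀ p).1.im * (act σ σ' A₀ p).2.im →
      Phi f k₁ k₂ p ≤ Phi f k₁ k₂ w := by
  set A := A₀⁻¹ with hA
  obtain ⟨N, hN0, hN⟩ := exists_denom A
  obtain ⟨u, v, e, he, huv, h1, h2, h3, h4⟩ := exists_unit σ σ' r hs0 hσ hσ' hd hsq hr hN0
  have he0 : 0 < e := by linarith
  have hper := per_slash σ σ' k₁ k₂ r hs0 hσ hσ' hmod A hN0 hN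
  let B := upperTri (1 + (N : F) * u) 0 (1 + (N : F) * v) huv
  obtain ⟨γ, hγ⟩ := exists_conj A hN B
    (fun i j => if i = 0 ∧ j = 0 then u else if i = 1 ∧ j = 1 then v else 0) (by
    intro i j
    fin_cases i <;> fin_cases j <;> simp [B, upperTri])
  have heC : (e : ℂ) ≠ 0 := by exact_mod_cast he0.ne'
  have key : ∀ p ∈ HH, ‖slash σ σ' k₁ k₂ f A (((e ^ 2 : ℝ) : ℂ) * p.1, (((e ^ 2)⁻¹ : ℝ) : ℂ) * p.2)‖ =
      ((e⁻¹) ^ k₁ * e ^ k₂) * ‖slash σ σ' k₁ k₂ f A p‖ := by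
    intro p hp
    have := slash_inv σ σ' k₁ k₂ A B (toF γ) (hmod γ) hγ hp
    rw [autf_upperTri, act_upperTri, h1, h2, h3, h4] at this
    have e1 : (((e ^ 2 : ℝ) : ℂ) * p.1, (((e ^ 2)⁻¹ : ℝ) : ℂ) * p.2) =
        (((e : ℂ) * p.1 + ((σ 0 : ℝ) : ℂ)) / ((e⁻¹ : ℝ) : ℂ),
          (((e⁻¹ : ℝ) : ℂ) * p.2 + ((σ' 0 : ℝ) : ℂ)) / (e : ℂ)) := by
      apply Prod.ext
      · simp; ring
      · simp; field_simp
    rw [e1, this, norm_mul, norm_mul, norm_zpow, norm_zpow, Complex.norm_real, Complex.norm_real,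
      Real.norm_of_nonneg he0.le, Real.norm_of_nonneg (by positivity)]
  obtain ⟨w, hw, hmax⟩ := siegel (k₁ := k₁) (k₂ := k₂) hk (differentiableOn_slash σ σ' k₁ k₂ hf A)
    hper (l := e ^ 2) (c := (e⁻¹) ^ k₁ * e ^ k₂) (one_lt_pow₀ he two_ne_zero) (by positivity) key
    (by
      have a1 : (e ^ 2) ^ k₁ = (e ^ k₁) ^ 2 := by
        rw [← zpow_natCast, ← zpow_natCast, ← zpow_mul, ← zpow_mul, mul_comm]
      have a2 : (e ^ 2) ^ k₂ = (e ^ k₂) ^ 2 := by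
        rw [← zpow_natCast, ← zpow_natCast, ← zpow_mul, ← zpow_mul, mul_comm]
      rw [inv_zpow, inv_zpow, a1, a2]
      have : e ^ k₁ ≠ 0 := by positivity
      have : e ^ k₂ ≠ 0 := by positivity
      field_simp) ht
  refine ⟨act σ σ' A w, act_mem σ σ' A hw, fun p hp hpt => ?_⟩
  have hpp : act σ σ' A (act σ σ' A₀ p) = p := by
    rw [← act_mul _ _ _ _ hp, hA, inv_mul_cancel, act_one]
  rw [Phi_slash σ σ' k₁ k₂ f A hw]
  conv_lhs => rw [← hpp]
  rw [Phi_slash σ σ' k₁ k₂ f A (act_mem σ σ' A₀ hp)]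
  exact hmax _ (act_mem σ σ' A₀ hp) hpt

end cusp

section arith

open NumberField

variable {F : Type*} [Field F] [NumberField F]

lemma one_le_norm (hrank : Module.finrank ℚ F = 2) (σ σ' : F →+* ℝ) (hσ : σ ≠ σ') {α : 𝓞 F}
    (hα : α ≠ 0) : 1 ≤ |σ (α : F) * σ' (α : F)| := by
  classical
  let τ : F →ₐ[ℚ] ℂ := (Complex.ofRealHom.comp σ).toRatAlgHom
  let τ' : F →ₐ[ℚ] ℂ := (Complex.ofRealHom.comp σ').toRatAlgHom
  have hne : τ ≠ τ' := by
    intro h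
    apply hσ
    ext x
    have := DFunLike.congr_fun h x
    have h2 : ((σ x : ℝ) : ℂ) = ((σ' x : ℝ) : ℂ) := this
    exact_mod_cast h2
  have huniv : (Finset.univ : Finset (F →ₐ[ℚ] ℂ)) = {τ, τ'} := by
    symm
    apply Finset.eq_univ_of_card
    rw [Finset.card_pair hne, AlgHom.card, hrank]
  have h1 := Algebra.norm_eq_prod_embeddings ℚ ℂ (α : F)
  rw [huniv, Finset.prod_pair hne, ← Algebra.coe_norm_int] at h1
  have h2 : ((Algebra.norm ℤ α : ℤ) : ℂ) = ((σ (α : F) * σ' (α : F) : ℝ) : ℂ) := by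
    push_cast
    rw [← show τ (α : F) = ((σ (α : F) : ℝ) : ℂ) from rfl,
      ← show τ' (α : F) = ((σ' (α : F) : ℝ) : ℂ) from rfl, ← h1]
    simp
  have h3 : ((Algebra.norm ℤ α : ℤ) : ℝ) = σ (α : F) * σ' (α : F) := by exact_mod_cast h2
  rw [← h3]
  have h4 : Algebra.norm ℤ α ≠ 0 := Algebra.norm_ne_zero_iff.2 hα
  exact_mod_cast Int.one_le_abs h4

open Ideal in
lemma same_ideal {R : Type*} [CommRing R] [IsDedekindDomain R] {c d c' d' : R}
    (h : span {c, d} = span ({c', d'} : Set R)) (h0 : span ({c, d} : Set R) ≠ ⊥) :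
    ∃ γ : Matrix.SpecialLinearGroup (Fin 2) R,
      c' * γ 0 0 + d' * γ 1 0 = c ∧ c' * γ 0 1 + d' * γ 1 1 = d := by
  set I := span ({c, d} : Set R) with hI
  obtain ⟨e, heI, he0⟩ := Submodule.exists_mem_ne_zero_of_ne_bot h0
  obtain ⟨J, hJ⟩ : I ∣ span {e} := by
    rw [Ideal.dvd_iff_le, Ideal.span_singleton_le_iff_mem]; exact heI
  have hmul : ∀ x ∈ I, ∀ j ∈ J, ∃ g, e * g = x * j := by
    intro x hx j hj
    have : x * j ∈ span {e} := hJ ▸ Ideal.mul_mem_mul hx hj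
    obtain ⟨g, hg⟩ := Ideal.mem_span_singleton'.1 this
    exact ⟨g, by rw [← hg, mul_comm]⟩
  have hex : ∀ a b : R, I = span {a, b} → ∃ u ∈ J, ∃ v ∈ J, e = a * u + b * v := by
    intro a b hab
    have : e ∈ I * J := hJ ▸ Ideal.mem_span_singleton_self e
    rw [hab, Ideal.span_insert, Ideal.sup_mul] at this
    obtain ⟨x, hx, y, hy, hxy⟩ := Submodule.mem_sup.1 this
    obtain ⟨u, hu, rfl⟩ := Ideal.mem_span_singleton_mul.1 hx
    obtain ⟨v, hv, rfl⟩ := Ideal.mem_span_singleton_mul.1 hy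
    exact ⟨u, hu, v, hv, hxy.symm⟩
  obtain ⟨u, hu, v, hv, h1⟩ := hex c d rfl
  obtain ⟨u', hu', v', hv', h2⟩ := hex c' d' h
  have hc : c ∈ I := subset_span (by simp)
  have hd : d ∈ I := subset_span (by simp)
  have hc' : c' ∈ I := h ▸ subset_span (by simp)
  have hd' : d' ∈ I := h ▸ subset_span (by simp)
  obtain ⟨a1, ha1⟩ := hmul d' hd' v hv
  obtain ⟨a2, ha2⟩ := hmul c hc u' hu'
  obtain ⟨b1, hb1⟩ := hmul d' hd' u hu
  obtain ⟨b2, hb2⟩ := hmul d hd u' hu'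
  obtain ⟨c1, hc1⟩ := hmul c' hc' v hv
  obtain ⟨c2, hc2⟩ := hmul c hc v' hv'
  obtain ⟨d1, hd1⟩ := hmul c' hc' u hu
  obtain ⟨d2, hd2⟩ := hmul d hd v' hv'
  refine ⟨⟨!![a1 + a2, -b1 + b2; -c1 + c2, d1 + d2], ?_⟩, ?_, ?_⟩
  · rw [Matrix.det_fin_two_of]
    have : e * e ≠ 0 := mul_ne_zero he0 he0
    apply mul_left_cancel₀ this
    have e1 : e * e * ((a1 + a2) * (d1 + d2) - (-b1 + b2) * (-c1 + c2)) =
      (e * a1 + e * a2) * (e * d1 + e * d2) - (-(e * b1) + e * b2) * (-(e * c1) + e * c2) := by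
      ring
    rw [e1, ha1, ha2, hb1, hb2, hc1, hc2, hd1, hd2]
    have e2 : e * e = (c * u + d * v) * (c' * u' + d' * v') := by rw [← h1, ← h2]
    rw [mul_one, e2]
    ring
  · simp
    apply mul_left_cancel₀ he0
    have e1 : e * (c' * (a1 + a2) + d' * (-c1 + c2)) =
      c' * (e * a1 + e * a2) + d' * (-(e * c1) + e * c2) := by ring
    rw [e1, ha1, ha2, hc1, hc2]
    linear_combination (-c) * h2
  · simp
    apply mul_left_cancel₀ he0
    have e1 : e * (c' * (-b1 + b2) + d' * (d1 + d2)) =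
      c' * (-(e * b1) + e * b2) + d' * (e * d1 + e * d2) := by ring
    rw [e1, hb1, hb2, hd1, hd2]
    linear_combination (-d) * h2

end arith

section mink

open MeasureTheory NumberField

lemma mink_aux (M : Matrix (Fin 4) (Fin 4) ℝ) (hM : M.det ≠ 0) {R : ℝ} (hR : 0 < R)
  (h : |M.det| < R ^ 4) : ∃ v : Fin 4 → ℤ, v ≠ 0 ∧ ∀ i, |(M.mulVec (fun j => (v j : ℝ))) i| ≤ R := by
  let b := Pi.basisFun ℝ (Fin 4)
  have hfund := ZSpan.isAddFundamentalDomain' b volume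
  have hvol : volume (ZSpan.fundamentalDomain b) = 1 := by
    rw [ZSpan.volume_fundamentalDomain]
    have : (Matrix.of b) = 1 := by
      ext i j
      simp [b, Matrix.one_apply, Pi.single_apply, eq_comm]
    rw [this]; simp
  let S : Set (Fin 4 → ℝ) := (Matrix.toLin' M) ⁻¹' (Metric.closedBall 0 R)
  have hS : volume S = ENNReal.ofReal |(M.det)⁻¹| * ENNReal.ofReal ((2 * R) ^ 4) := by
    rw [Measure.addHaar_preimage_linearMap _ (by simpa using hM), Real.volume_pi_closedBall _ hR.le]
    simp
  have hconv : Convex ℝ S := (convex_closedBall 0 R).linear_preimage _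
  have hsymm : ∀ x ∈ S, -x ∈ S := by
    intro x hx
    simp only [S, Set.mem_preimage, mem_closedBall_zero_iff, map_neg, norm_neg] at hx ⊢
    exact hx
  have : Countable (Submodule.span ℤ (Set.range b)).toAddSubgroup :=
    inferInstanceAs (Countable (Submodule.span ℤ (Set.range b)))
  obtain ⟨x, hx0, hxS⟩ := exists_ne_zero_mem_lattice_of_measure_mul_two_pow_lt_measure hfund hsymm hconv
    (by
      rw [hvol, hS, ← ENNReal.ofReal_mul (abs_nonneg _)]
      simp only [Module.finrank_fintype_fun_eq_card, Fintype.card_fin, one_mul]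
      rw [show (2 : ENNReal) ^ 4 = ENNReal.ofReal (2 ^ 4) by
        rw [ENNReal.ofReal_pow (by norm_num)]; simp]
      rw [ENNReal.ofReal_lt_ofReal_iff (by positivity), abs_inv, mul_pow]
      have h0 : 0 < |M.det| := abs_pos.2 hM
      rw [inv_mul_eq_div, lt_div_iff₀ h0]
      nlinarith)
  have hxm : (x : Fin 4 → ℝ) ∈ Submodule.span ℤ (Set.range b) := x.2
  rw [Module.Basis.mem_span_iff_repr_mem] at hxm
  choose v hv using hxm
  have hv' : (fun j => (v j : ℝ)) = (x : Fin 4 → ℝ) := by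
    ext j
    have := hv j
    simpa [b] using this
  refine ⟨v, ?_, fun i => ?_⟩
  · rintro rfl
    apply hx0
    ext j
    have := congrFun hv' j
    simp at this
    simp [← this]
  · rw [hv']
    simp only [S, Set.mem_preimage, mem_closedBall_zero_iff] at hxS
    have := (norm_le_pi_norm _ i).trans hxS
    simpa using this

variable {F : Type*} [Field F] [NumberField F]

lemma minkowski (σ σ' : F →+* ℝ) (r : 𝓞 F) {s : ℝ} (hs0 : s ≠ 0)
    (hσ : σ (r : F) = s) (hσ' : σ' (r : F) = -s) :
    ∃ B : ℝ, 0 < B ∧ ∀ p ∈ HH, ∃ c d : 𝓞 F, ¬ (c = 0 ∧ d = 0) ∧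
      ‖(σ (c : F) : ℂ) * p.1 + (σ (d : F) : ℂ)‖ ^ 2 * ‖(σ' (c : F) : ℂ) * p.2 + (σ' (d : F) : ℂ)‖ ^ 2
        ≤ B * (p.1.im * p.2.im) := by
  set R : ℝ := 4 * s ^ 2 + 1 with hR
  have hs2 : 0 < s ^ 2 := by positivity
  have hR0 : 0 < R := by positivity
  refine ⟨4 * R ^ 4, by positivity, fun p hp => ?_⟩
  obtain ⟨⟨x1, y1⟩, ⟨x2, y2⟩⟩ := p
  obtain ⟨hy1, hy2⟩ := hp
  simp only at hy1 hy2
  obtain ⟨m1, hm1, rfl⟩ : ∃ m : ℝ, 0 < m ∧ y1 = m ^ 2 :=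
    ⟨√y1, Real.sqrt_pos.2 hy1, (Real.sq_sqrt hy1.le).symm⟩
  obtain ⟨m2, hm2, rfl⟩ : ∃ m : ℝ, 0 < m ∧ y2 = m ^ 2 :=
    ⟨√y2, Real.sqrt_pos.2 hy2, (Real.sq_sqrt hy2.le).symm⟩
  let M : Matrix (Fin 4) (Fin 4) ℝ :=
    !![x1 / m1, s * x1 / m1, 1 / m1, s / m1; m1, s * m1, 0, 0;
      x2 / m2, -s * x2 / m2, 1 / m2, -s / m2; m2, -s * m2, 0, 0]
  have hdet : |M.det| = 4 * s ^ 2 := by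
    have : M.det = -(4 * s ^ 2) ∨ M.det = 4 * s ^ 2 := by
      first
      | left
        simp [M, Matrix.det_succ_row_zero, Fin.sum_univ_succ, Fin.succAbove]
        field_simp
        ring
      | right
        simp [M, Matrix.det_succ_row_zero, Fin.sum_univ_succ, Fin.succAbove]
        field_simp
        ring
    rcases this with h | h <;> rw [h]
    · rw [abs_neg, abs_of_pos (by positivity)]
    · rw [abs_of_pos (by positivity)]
  have hdet0 : M.det ≠ 0 := by
    intro h
    rw [h] at hdet
    simp at hdet
    exact hs0 hdet
  obtain ⟨v, hv0, hv⟩ := mink_aux M hdet0 hR0 (by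
    rw [hdet]
    have : R ^ 1 ≤ R ^ 4 := pow_le_pow_right₀ (by linarith) (by norm_num)
    linarith)
  let c : 𝓞 F := (v 0 : 𝓞 F) + (v 1 : 𝓞 F) * r
  let d : 𝓞 F := (v 2 : 𝓞 F) + (v 3 : 𝓞 F) * r
  have hc1 : σ (c : F) = v 0 + v 1 * s := by
    simp only [c, map_add, map_mul, map_intCast, hσ]
  have hc2 : σ' (c : F) = v 0 - v 1 * s := by
    simp only [c, map_add, map_mul, map_intCast, hσ']; ring
  have hd1 : σ (d : F) = v 2 + v 3 * s := by
    simp only [d, map_add, map_mul, map_intCast, hσ]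
  have hd2 : σ' (d : F) = v 2 - v 3 * s := by
    simp only [d, map_add, map_mul, map_intCast, hσ']; ring
  refine ⟨c, d, ?_, ?_⟩
  · rintro ⟨h1, h2⟩
    rw [h1] at hc1 hc2
    rw [h2] at hd1 hd2
    simp only [map_zero] at hc1 hc2 hd1 hd2
    apply hv0
    have a0 : (v 0 : ℝ) = 0 := by linarith
    have a2 : (v 2 : ℝ) = 0 := by linarith
    have a1 : (v 1 : ℝ) = 0 := by
      have : (v 1 : ℝ) * s = 0 := by linarith
      simpa [hs0] using this
    have a3 : (v 3 : ℝ) = 0 := by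
      have : (v 3 : ℝ) * s = 0 := by linarith
      simpa [hs0] using this
    ext i
    fin_cases i
    · exact_mod_cast a0
    · exact_mod_cast a1
    · exact_mod_cast a2
    · exact_mod_cast a3
  · have l0 := hv 0
    have l1 := hv 1
    have l2 := hv 2
    have l3 := hv 3
    simp only [M, Matrix.mulVec, dotProduct, Fin.sum_univ_four] at l0 l1 l2 l3
    simp at l0 l1 l2 l3
    have q0 := pow_le_pow_left₀ (abs_nonneg _) l0 2
    have q1 := pow_le_pow_left₀ (abs_nonneg _) l1 2
    have q2 := pow_le_pow_left₀ (abs_nonneg _) l2 2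
    have q3 := pow_le_pow_left₀ (abs_nonneg _) l3 2
    rw [sq_abs] at q0 q1 q2 q3
    have b1 : ‖(σ (c : F) : ℂ) * ⟨x1, m1 ^ 2⟩ + (σ (d : F) : ℂ)‖ ^ 2 ≤ 2 * R ^ 2 * m1 ^ 2 := by
      rw [← Complex.normSq_eq_norm_sq, Complex.normSq_apply]
      simp only [Complex.add_re, Complex.add_im, Complex.mul_re, Complex.mul_im, Complex.ofReal_re,
        Complex.ofReal_im, hc1, hd1]
      have h1 := mul_le_mul_of_nonneg_right (add_le_add q0 q1) (sq_nonneg m1)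
      refine le_trans (le_of_eq ?_) (h1.trans (le_of_eq (by ring)))
      field_simp
      ring
    have b2 : ‖(σ' (c : F) : ℂ) * ⟨x2, m2 ^ 2⟩ + (σ' (d : F) : ℂ)‖ ^ 2 ≤ 2 * R ^ 2 * m2 ^ 2 := by
      rw [← Complex.normSq_eq_norm_sq, Complex.normSq_apply]
      simp only [Complex.add_re, Complex.add_im, Complex.mul_re, Complex.mul_im, Complex.ofReal_re,
        Complex.ofReal_im, hc2, hd2]
      have h1 := mul_le_mul_of_nonneg_right (add_le_add q2 q3) (sq_nonneg m2)
      refine le_trans (le_of_eq ?_) (h1.trans (le_of_eq (by ring)))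
      field_simp
      ring
    calc _ ≤ (2 * R ^ 2 * m1 ^ 2) * (2 * R ^ 2 * m2 ^ 2) := by gcongr
      _ = _ := by ring

end mink

section reduction

open NumberField nonZeroDivisors

variable {F : Type*} [Field F] [NumberField F]

lemma exists_row (c d : F) (h : ¬ (c = 0 ∧ d = 0)) :
    ∃ A : Matrix.SpecialLinearGroup (Fin 2) F, A 1 0 = c ∧ A 1 1 = d := by
  by_cases hc : c = 0
  · have hd : d ≠ 0 := fun hd => h ⟨hc, hd⟩
    exact ⟨⟨!![d⁻¹, 0; c, d], by rw [Matrix.det_fin_two_of]; field_simp; simp⟩, rfl, rfl⟩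
  · exact ⟨⟨!![0, -c⁻¹; c, d], by rw [Matrix.det_fin_two_of]; field_simp; simp⟩, rfl, rfl⟩

/-- The denominator of the product of imaginary parts. -/
noncomputable def DD (σ σ' : F →+* ℝ) (c d : F) (p : ℂ × ℂ) : ℝ :=
  ‖(σ c : ℂ) * p.1 + (σ d : ℂ)‖ ^ 2 * ‖(σ' c : ℂ) * p.2 + (σ' d : ℂ)‖ ^ 2

lemma DD_smul (σ σ' : F →+* ℝ) (a c d : F) (p : ℂ × ℂ) :
    DD σ σ' (a * c) (a * d) p = |σ a * σ' a| ^ 2 * DD σ σ' c d p := by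
  have h : ∀ (τ : F →+* ℝ) (z : ℂ), (τ (a * c) : ℂ) * z + (τ (a * d) : ℂ) =
      (τ a : ℂ) * ((τ c : ℂ) * z + (τ d : ℂ)) := by
    intro τ z
    simp only [map_mul]
    push_cast
    ring
  rw [DD, DD, h, h, norm_mul, norm_mul, Complex.norm_real, Complex.norm_real, abs_mul,
    Real.norm_eq_abs, Real.norm_eq_abs]
  ring

lemma im_prod (σ σ' : F →+* ℝ) (A : Matrix.SpecialLinearGroup (Fin 2) F) {p : ℂ × ℂ}
    (hp : p ∈ HH) : 0 < DD σ σ' (A 1 0) (A 1 1) p ∧ (act σ σ' A p).1.im * (act σ σ' A p).2.im =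
      p.1.im * p.2.im / DD σ σ' (A 1 0) (A 1 1) p := by
  have h1 := norm_pos_iff.2 (den_ne (Matrix.SpecialLinearGroup.map σ A) hp.1)
  have h2 := norm_pos_iff.2 (den_ne (Matrix.SpecialLinearGroup.map σ' A) hp.2)
  have e : DD σ σ' (A 1 0) (A 1 1) p = ‖den (Matrix.SpecialLinearGroup.map σ A) p.1‖ ^ 2 *
    ‖den (Matrix.SpecialLinearGroup.map σ' A) p.2‖ ^ 2 := rfl
  rw [e]
  refine ⟨by positivity, ?_⟩
  simp only [act]
  rw [im_mob _ hp.1, im_mob _ hp.2]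
  field_simp

open Ideal in
lemma dvd_aux {R : Type*} [CommRing R] [IsDomain R] {x y e : R} {I J : Ideal R}
    (hxy : span {x} * I = span {y} * J) (hy : y ≠ 0) (he : e ≠ 0) (heJ : e ∈ J) :
    ∃ g, g ≠ 0 ∧ y * e = x * g := by
  have h : y * e ∈ span {x} * I := by
    rw [hxy]
    exact Ideal.mul_mem_mul (Ideal.mem_span_singleton_self y) heJ
  obtain ⟨g, hg⟩ := Ideal.mem_span_singleton'.1 (Ideal.mul_le_left h)
  refine ⟨g, ?_, by rw [← hg, mul_comm]⟩
  rintro rfl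
  rw [zero_mul] at hg
  exact mul_ne_zero hy he hg.symm

open Ideal in
lemma class_arith (hrank : Module.finrank ℚ F = 2)
    (σ σ' : F →+* ℝ) (hne : σ ≠ σ') (c d c₀ d₀ x y e₀ : 𝓞 F)
    (h : span {c, d} ≠ (⊥ : Ideal (𝓞 F))) (hx : x ≠ 0) (hy : y ≠ 0)
    (hxy : span {x} * span {c, d} = span {y} * span {c₀, d₀})
    (he₀ : e₀ ≠ 0) (he₀mem : e₀ ∈ span ({c₀, d₀} : Set (𝓞 F)))
    (A₀ : Matrix.SpecialLinearGroup (Fin 2) F) (hA1 : A₀ 1 0 = (c₀ : F)) (hA2 : A₀ 1 1 = (d₀ : F)) :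
    ∃ γ : Matrix.SpecialLinearGroup (Fin 2) (𝓞 F), ∀ p : ℂ × ℂ,
      DD σ σ' ((A₀ * toF γ) 1 0) ((A₀ * toF γ) 1 1) p ≤
        |σ (e₀ : F) * σ' (e₀ : F)| ^ 2 * DD σ σ' (c : F) (d : F) p := by
  set m := |σ (e₀ : F) * σ' (e₀ : F)| with hm
  have hsp : ∀ a b c : 𝓞 F, span {a} * span {b, c} = span ({a * b, a * c} : Set (𝓞 F)) := by
    intro a b c
    rw [Ideal.span_insert, Ideal.mul_sup, Ideal.span_singleton_mul_span_singleton,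
      Ideal.span_singleton_mul_span_singleton, ← Ideal.span_insert]
  have hxy' := hxy
  rw [hsp, hsp] at hxy'
  obtain ⟨γ, hγ1, hγ2⟩ := same_ideal hxy' (by
    rw [← hsp]
    exact mul_ne_zero (by simpa using hx) h)
  obtain ⟨g, hg0, hg⟩ := dvd_aux hxy hy he₀ he₀mem
  have hG := one_le_norm hrank σ σ' hne hg0
  have hX := one_le_norm hrank σ σ' hne hx
  have hY := one_le_norm hrank σ σ' hne hy
  set X := |σ (x : F) * σ' (x : F)| with hXd
  set Y := |σ (y : F) * σ' (y : F)| with hYd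
  set G := |σ (g : F) * σ' (g : F)| with hGd
  have hYm : Y * m = X * G := by
    rw [hYd, hm, hXd, hGd, ← abs_mul, ← abs_mul]
    have hgF : (y : F) * e₀ = x * g := by
      rw [← map_mul, ← map_mul, hg]
    have e1 : σ (y : F) * σ (e₀ : F) = σ (x : F) * σ (g : F) := by
      rw [← map_mul σ, hgF, map_mul]
    have e2 : σ' (y : F) * σ' (e₀ : F) = σ' (x : F) * σ' (g : F) := by
      rw [← map_mul σ', hgF, map_mul]
    congr 1
    linear_combination (σ' (y : F) * σ' (e₀ : F)) * e1 + (σ (x : F) * σ (g : F)) * e2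
  refine ⟨γ, fun p => ?_⟩
  have hm1 : 1 ≤ m := one_le_norm hrank σ σ' hne he₀
  set A := A₀ * toF γ with hA
  have hA10 : (y : F) * A 1 0 = x * c := by
    have : A 1 0 = A₀ 1 0 * (γ 0 0 : F) + A₀ 1 1 * (γ 1 0 : F) := by
      rw [hA, Matrix.SpecialLinearGroup.coe_mul, Matrix.mul_apply, Fin.sum_univ_two]; rfl
    rw [this, hA1, hA2]
    have := congrArg (algebraMap (𝓞 F) F) hγ1
    simp only [map_add, map_mul] at this
    rw [← this]
    ring
  have hA11 : (y : F) * A 1 1 = x * d := by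
    have : A 1 1 = A₀ 1 0 * (γ 0 1 : F) + A₀ 1 1 * (γ 1 1 : F) := by
      rw [hA, Matrix.SpecialLinearGroup.coe_mul, Matrix.mul_apply, Fin.sum_univ_two]; rfl
    rw [this, hA1, hA2]
    have := congrArg (algebraMap (𝓞 F) F) hγ2
    simp only [map_add, map_mul] at this
    rw [← this]
    ring
  have hDD : Y ^ 2 * DD σ σ' (A 1 0) (A 1 1) p = X ^ 2 * DD σ σ' (c : F) (d : F) p := by
    rw [← DD_smul, ← DD_smul, hA10, hA11]
  have hY2 : 0 < Y ^ 2 := by positivity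
  have hXY : X ≤ Y * m := by rw [hYm]; nlinarith
  have hD0 : 0 ≤ DD σ σ' (c : F) (d : F) p := by unfold DD; positivity
  apply le_of_mul_le_mul_left _ hY2
  rw [hDD]
  calc X ^ 2 * DD σ σ' (c : F) (d : F) p ≤ (Y * m) ^ 2 * DD σ σ' (c : F) (d : F) p := by gcongr
    _ = _ := by ring

open Ideal in
lemma class_bound (hrank : Module.finrank ℚ F = 2)
    (σ σ' : F →+* ℝ) (hne : σ ≠ σ') {k₁ k₂ : ℤ} (hk : k₁ ≤ 0) (r : 𝓞 F) {s : ℝ} (hs0 : s ≠ 0)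
    (hσ : σ (r : F) = s) (hσ' : σ' (r : F) = -s) {d : ℤ} (hd : 1 < d) (hsq : ¬ IsSquare d)
    (hr : (r : F) ^ 2 = d) {f : ℂ × ℂ → ℂ} (hf : DifferentiableOn ℂ f HH)
    (hmod : ∀ γ : Matrix.SpecialLinearGroup (Fin 2) (𝓞 F), ∀ p ∈ HH,
      f (act σ σ' (toF γ) p) = autf σ σ' k₁ k₂ (toF γ) p * f p) {B : ℝ} (hB : 0 < B)
    (C : ClassGroup (𝓞 F)) :
    ∃ w ∈ HH, ∀ p ∈ HH, ∀ (c d : 𝓞 F) (h : span {c, d} ∈ (Ideal (𝓞 F))⁰),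
      ClassGroup.mk0 ⟨span {c, d}, h⟩ = C → DD σ σ' (c : F) (d : F) p ≤ B * (p.1.im * p.2.im) →
      Phi f k₁ k₂ p ≤ Phi f k₁ k₂ w := by
  by_cases hex : ∃ (c₀ d₀ : 𝓞 F) (h₀ : span {c₀, d₀} ∈ (Ideal (𝓞 F))⁰),
      ClassGroup.mk0 ⟨span {c₀, d₀}, h₀⟩ = C
  swap
  · refine ⟨(Complex.I, Complex.I), by simp [HH], fun p _ c d h hC => ?_⟩
    exact absurd ⟨c, d, h, hC⟩ hex
  obtain ⟨c₀, d₀, h₀, hC₀⟩ := hex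
  obtain ⟨e₀, he₀, he₀mem⟩ : ∃ e₀ : 𝓞 F, e₀ ≠ 0 ∧ e₀ ∈ span ({c₀, d₀} : Set (𝓞 F)) := by
    obtain ⟨e, he, he0⟩ := Submodule.exists_mem_ne_zero_of_ne_bot (nonZeroDivisors.ne_zero h₀)
    exact ⟨e, he0, he⟩
  have hrow : ¬ ((c₀ : F) = 0 ∧ (d₀ : F) = 0) := by
    rintro ⟨h1, h2⟩
    apply nonZeroDivisors.ne_zero h₀
    have h1' : c₀ = 0 := by exact_mod_cast h1
    have h2' : d₀ = 0 := by exact_mod_cast h2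
    rw [h1', h2']
    simp
  obtain ⟨A₀, hA1, hA2⟩ := exists_row (c₀ : F) (d₀ : F) hrow
  set m := |σ (e₀ : F) * σ' (e₀ : F)| with hm
  have hm1 : 1 ≤ m := one_le_norm hrank σ σ' hne he₀
  have hm0 : 0 < m := by linarith
  obtain ⟨w, hw, hwmax⟩ := cusp_bound σ σ' hk r hs0 hσ hσ' hd hsq hr hf hmod A₀
    (t := 1 / (B * m ^ 2)) (by positivity)
  refine ⟨w, hw, fun p hp c d h hC hle => ?_⟩
  rw [← hC₀, ClassGroup.mk0_eq_mk0_iff] at hC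
  obtain ⟨x, y, hx, hy, hxy⟩ := hC
  obtain ⟨γ, hγ⟩ := class_arith hrank σ σ' hne c d c₀ d₀ x y e₀ (nonZeroDivisors.ne_zero h) hx hy hxy
    he₀ he₀mem A₀ hA1 hA2
  have hDD := hγ p
  set A := A₀ * toF γ with hA
  obtain ⟨hpos, him⟩ := im_prod σ σ' A hp
  set q := act σ σ' (toF γ) p with hq
  have hqm : q ∈ HH := act_mem σ σ' _ hp
  have hPhi : Phi f k₁ k₂ q = Phi f k₁ k₂ p := Phi_transform σ σ' k₁ k₂ f f (toF γ) hp (hmod γ p hp)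
  rw [← hPhi]
  apply hwmax q hqm
  rw [hq, ← act_mul σ σ' A₀ (toF γ) hp, him, div_le_div_iff₀ (by positivity) hpos, one_mul]
  have hyy : 0 < p.1.im * p.2.im := mul_pos hp.1 hp.2
  refine hDD.trans ?_
  calc m ^ 2 * DD σ σ' (c : F) (d : F) p ≤ m ^ 2 * (B * (p.1.im * p.2.im)) := by gcongr
    _ = _ := by ring

open Ideal in
lemma exists_global_max (hrank : Module.finrank ℚ F = 2)
    (σ σ' : F →+* ℝ) (hne : σ ≠ σ') {k₁ k₂ : ℤ} (hk : k₁ ≤ 0) (r : 𝓞 F) {s : ℝ} (hs0 : s ≠ 0)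
    (hσ : σ (r : F) = s) (hσ' : σ' (r : F) = -s) {d : ℤ} (hd : 1 < d) (hsq : ¬ IsSquare d)
    (hr : (r : F) ^ 2 = d) {f : ℂ × ℂ → ℂ} (hf : DifferentiableOn ℂ f HH)
    (hmod : ∀ γ : Matrix.SpecialLinearGroup (Fin 2) (𝓞 F), ∀ p ∈ HH,
      f (act σ σ' (toF γ) p) = autf σ σ' k₁ k₂ (toF γ) p * f p) :
    ∃ w ∈ HH, ∀ p ∈ HH, Phi f k₁ k₂ p ≤ Phi f k₁ k₂ w := by
  obtain ⟨B, hB, hmink⟩ := minkowski σ σ' r hs0 hσ hσ'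
  choose W hW hWmax using
    class_bound hrank σ σ' hne hk r hs0 hσ hσ' hd hsq hr hf hmod hB
  obtain ⟨C₀, hC₀⟩ := Finite.exists_max (fun C : ClassGroup (𝓞 F) => Phi f k₁ k₂ (W C))
  refine ⟨W C₀, hW C₀, fun p hp => ?_⟩
  obtain ⟨c, d, hcd, hle⟩ := hmink p hp
  have h : span {c, d} ∈ (Ideal (𝓞 F))⁰ := by
    apply mem_nonZeroDivisors_of_ne_zero
    intro h0
    have h0' : span ({c, d} : Set (𝓞 F)) = ⊥ := h0
    rw [Ideal.span_eq_bot] at h0'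
    exact hcd ⟨h0' c (by simp), h0' d (by simp)⟩
  exact (hWmax _ p hp c d h rfl hle).trans (hC₀ _)

end reduction

section core

open NumberField Filter Topology

variable {F : Type*} [Field F] [NumberField F]

lemma toF_ent (γ : Matrix.SpecialLinearGroup (Fin 2) (𝓞 F)) (i j : Fin 2) :
    (toF γ) i j = (γ i j : F) := rfl

/-- Integral unipotent matrix. -/
def upO (b : 𝓞 F) : Matrix.SpecialLinearGroup (Fin 2) (𝓞 F) :=
  ⟨!![1, b; 0, 1], by rw [Matrix.det_fin_two_of]; ring⟩

lemma toF_upper (b : 𝓞 F) : toF (upO b) = upperTri (1 : F) (b : F) 1 (by ring) := by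
  ext i j
  rw [toF_ent]
  fin_cases i <;> fin_cases j <;> simp [upO, upperTri]

lemma transl (σ σ' : F →+* ℝ) {k₁ k₂ : ℤ} {f : ℂ × ℂ → ℂ}
    (hmod : ∀ γ : Matrix.SpecialLinearGroup (Fin 2) (𝓞 F), ∀ p ∈ HH,
      f (act σ σ' (toF γ) p) = autf σ σ' k₁ k₂ (toF γ) p * f p) (b : 𝓞 F) {p : ℂ × ℂ} (hp : p ∈ HH) :
    f (p.1 + (σ (b : F) : ℂ), p.2 + (σ' (b : F) : ℂ)) = f p := by
  have h := hmod (upO b) p hp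
  rw [toF_upper, act_upperTri, autf_upperTri] at h
  simpa using h

lemma core (hrank : Module.finrank ℚ F = 2)
    (σ σ' : F →+* ℝ) (hne : σ ≠ σ') {k₁ k₂ : ℤ} (hk : k₁ ≤ 0) (r : 𝓞 F) {s : ℝ} (hs0 : s ≠ 0)
    (hσ : σ (r : F) = s) (hσ' : σ' (r : F) = -s) {d : ℤ} (hd : 1 < d) (hsq : ¬ IsSquare d)
    (hr : (r : F) ^ 2 = d) {f : ℂ × ℂ → ℂ} (hf : DifferentiableOn ℂ f HH)
    (hmod : ∀ γ : Matrix.SpecialLinearGroup (Fin 2) (𝓞 F), ∀ p ∈ HH,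
      f (act σ σ' (toF γ) p) = autf σ σ' k₁ k₂ (toF γ) p * f p) :
    (k₁ < 0 → ∀ p ∈ HH, f p = 0) ∧ (k₁ = 0 → ∃ a, ∀ p ∈ HH, f p = a) := by
  obtain ⟨w, hw, hmax⟩ := exists_global_max hrank σ σ' hne hk r hs0 hσ hσ' hd hsq hr hf hmod
  obtain ⟨h1, h2⟩ := max_concl hk hf hw hmax
  refine ⟨h1, fun hk0 => ⟨f w, ?_⟩⟩
  have hconst := h2 hk0
  obtain ⟨u, v, e, he, -, -, hu, -, -⟩ :=
    exists_unit σ σ' r hs0 hσ hσ' hd hsq hr (N := 1) one_pos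
  have he0 : 0 < e := by linarith
  have hpts : ∀ (n : ℕ) (z : ℂ), 0 < z.im → f (z, w.2 + (((e⁻¹) ^ n : ℝ) : ℂ)) = f w := by
    intro n z hz
    let b : 𝓞 F := (1 + u) ^ n
    have hb : σ' (b : F) = (e⁻¹) ^ n := by
      rw [← hu]
      simp only [b, map_pow, map_add, map_one, Int.cast_one, one_mul]
    have hz' : 0 < (z - (σ (b : F) : ℂ)).im := by simpa using hz
    have h3 := transl σ σ' hmod b (p := (z - (σ (b : F) : ℂ), w.2)) ⟨hz', hw.2⟩
    simp only [sub_add_cancel, hb] at h3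
    rw [h3]
    exact hconst _ hz'
  rintro ⟨z, z'⟩ ⟨hz, hz'⟩
  simp only at hz hz'
  let U : Set ℂ := {x | 0 < x.im}
  have hU : IsOpen U := isOpen_lt continuous_const Complex.continuous_im
  have hUc : IsPreconnected U := (convex_halfSpace_im_gt 0).isPreconnected
  have hg : AnalyticOnNhd ℂ (fun x => f (z, x)) U := by
    apply DifferentiableOn.analyticOnNhd _ hU
    apply hf.comp (by fun_prop : DifferentiableOn ℂ (fun x : ℂ => (z, x)) U)
    intro x hx
    exact ⟨hz, hx⟩
  have hc : AnalyticOnNhd ℂ (fun _ : ℂ => f w) U := analyticOnNhd_const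
  have hlim : Tendsto (fun n : ℕ => w.2 + (((e⁻¹) ^ n : ℝ) : ℂ)) atTop (𝓝[≠] w.2) := by
    rw [tendsto_nhdsWithin_iff]
    constructor
    · have h0 : Tendsto (fun n : ℕ => (e⁻¹) ^ n) atTop (𝓝 0) :=
        tendsto_pow_atTop_nhds_zero_of_lt_one (by positivity) (inv_lt_one_of_one_lt₀ he)
      have h4 : Tendsto (fun n : ℕ => (((e⁻¹) ^ n : ℝ) : ℂ)) atTop (𝓝 ((0 : ℝ) : ℂ)) :=
        (Complex.continuous_ofReal.tendsto 0).comp h0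
      have h5 := h4.const_add w.2
      simpa using h5
    · refine Eventually.of_forall fun n => ?_
      have : (((e⁻¹) ^ n : ℝ) : ℂ) ≠ 0 := by
        have : (e⁻¹) ^ n ≠ 0 := by positivity
        exact_mod_cast this
      simpa using this
  have hfreq : ∃ᶠ x in 𝓝[≠] w.2, f (z, x) = f w :=
    hlim.frequently (Eventually.frequently (Eventually.of_forall fun n => hpts n z hz))
  have hzz : z' ∈ U := hz'
  exact hg.eqOn_of_preconnected_of_frequently_eq hc hUc hw.2 hfreq hzz

/-- Combination of the core result and the action of the inversion. -/
lemma core_zero (hrank : Module.finrank ℚ F = 2)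
    (σ σ' : F →+* ℝ) (hne : σ ≠ σ') {k₁ k₂ : ℤ} (hk : k₁ ≤ 0) (hk' : ¬ (k₁ = 0 ∧ k₂ = 0))
    (r : 𝓞 F) {s : ℝ} (hs0 : s ≠ 0)
    (hσ : σ (r : F) = s) (hσ' : σ' (r : F) = -s) {d : ℤ} (hd : 1 < d) (hsq : ¬ IsSquare d)
    (hr : (r : F) ^ 2 = d) {f : ℂ × ℂ → ℂ} (hf : DifferentiableOn ℂ f HH)
    (hmod : ∀ γ : Matrix.SpecialLinearGroup (Fin 2) (𝓞 F), ∀ p ∈ HH,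
      f (act σ σ' (toF γ) p) = autf σ σ' k₁ k₂ (toF γ) p * f p) :
    ∀ p ∈ HH, f p = 0 := by
  obtain ⟨h1, h2⟩ := core hrank σ σ' hne hk r hs0 hσ hσ' hd hsq hr hf hmod
  rcases lt_or_eq_of_le hk with h | h
  · exact h1 h
  · obtain ⟨a, ha⟩ := h2 h
    have hk2 : k₂ ≠ 0 := fun h0 => hk' ⟨h, h0⟩
    suffices a = 0 by intro p hp; rw [ha p hp, this]
    let S : Matrix.SpecialLinearGroup (Fin 2) (𝓞 F) :=
      ⟨!![0, -1; 1, 0], by rw [Matrix.det_fin_two_of]; ring⟩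
    have hp : ((Complex.I, 2 * Complex.I) : ℂ × ℂ) ∈ HH := by simp [HH]
    have h3 := hmod S _ hp
    rw [ha _ hp, ha _ (act_mem σ σ' _ hp)] at h3
    have h4 : autf σ σ' k₁ k₂ (toF S) (Complex.I, 2 * Complex.I) = (2 * Complex.I) ^ k₂ := by
      simp only [autf, den, map_ent, h, toF_ent]
      simp [S]
    rw [h4] at h3
    by_contra ha0
    have h5 : (2 * Complex.I) ^ k₂ = 1 := by
      apply mul_right_cancel₀ ha0
      rw [← h3, one_mul]
    have h6 := congrArg norm h5
    rw [norm_zpow, norm_mul, Complex.norm_I, norm_one] at h6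
    simp only [Complex.norm_ofNat, mul_one] at h6
    rw [zpow_eq_one_iff_right₀ (by norm_num) (by norm_num)] at h6
    exact hk2 h6

end core

section emb

lemma not_rational {F : Type*} [Field F] [NumberField F] {d : ℤ} (hsq : ¬ IsSquare d) {x : F}
    (hx : x ^ 2 = (d : F)) : x ∉ (⊥ : Subalgebra ℚ F) := by
  intro h
  obtain ⟨q, rfl⟩ := Algebra.mem_bot.1 h
  have h1 : q ^ 2 = (d : ℚ) := by
    apply (algebraMap ℚ F).injective
    rw [map_pow, hx, map_intCast]
  apply hsq
  rw [← Rat.isSquare_intCast_iff]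
  exact ⟨q, by rw [← h1, sq]⟩

lemma embeddings_eq {F : Type*} [Field F] [NumberField F] (hrank : Module.finrank ℚ F = 2) (x : F)
    (hx : x ∉ (⊥ : Subalgebra ℚ F)) {σ σ' : F →+* ℝ} (h : σ x = σ' x) : σ = σ' := by
  have hli : LinearIndependent ℚ ![(1 : F), x] := by
    rw [LinearIndependent.pair_iff' one_ne_zero]
    intro a ha
    apply hx
    rw [← ha, Algebra.smul_def, mul_one]
    exact Algebra.mem_bot.2 ⟨a, rfl⟩
  have hspan := hli.span_eq_top_of_card_eq_finrank' (by simp [hrank])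
  ext y
  have hy : y ∈ Submodule.span ℚ (Set.range ![(1 : F), x]) := by rw [hspan]; trivial
  rw [Matrix.range_cons, Matrix.range_cons, Matrix.range_empty, Set.union_empty,
    Set.singleton_union, Submodule.mem_span_pair] at hy
  obtain ⟨a, b, rfl⟩ := hy
  simp only [Algebra.smul_def, map_add, map_mul, eq_ratCast, map_ratCast, map_one, h]

end emb

/-- A holomorphic Hilbert modular form of weight `(k₁,k₂)` for `Γ_F = SL₂(𝒪_F)` vanishes
identically unless `k₁, k₂` are both positive or `k₁ = k₂ = 0`; in the latter case it is
constant. -/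
theorem hilbert_modular_form_weight_zero_or_positive
    (d : ℤ) (hd : 1 < d) (hsf : Squarefree d)
    (F : Type*) [Field F] [NumberField F]
    (hrank : Module.finrank ℚ F = 2)
    (sqrtd : F) (hsqrtd : sqrtd ^ 2 = (d : F))
    (σ σ' : F →+* ℝ) (hσ : σ ≠ σ')
    (k₁ k₂ : ℤ)
    (f : ℂ × ℂ → ℂ)
    (hf : DifferentiableOn ℂ f {p : ℂ × ℂ | 0 < p.1.im ∧ 0 < p.2.im})
    (hmod : ∀ γ : Matrix.SpecialLinearGroup (Fin 2) (NumberField.RingOfIntegers F),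
      ∀ p : ℂ × ℂ, 0 < p.1.im → 0 < p.2.im →
      f (((slEmbEntry σ γ 0 0 : ℂ) * p.1 + (slEmbEntry σ γ 0 1 : ℂ)) /
            ((slEmbEntry σ γ 1 0 : ℂ) * p.1 + (slEmbEntry σ γ 1 1 : ℂ)),
         ((slEmbEntry σ' γ 0 0 : ℂ) * p.2 + (slEmbEntry σ' γ 0 1 : ℂ)) /
            ((slEmbEntry σ' γ 1 0 : ℂ) * p.2 + (slEmbEntry σ' γ 1 1 : ℂ)))
        = ((slEmbEntry σ γ 1 0 : ℂ) * p.1 + (slEmbEntry σ γ 1 1 : ℂ)) ^ k₁ *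
            ((slEmbEntry σ' γ 1 0 : ℂ) * p.2 + (slEmbEntry σ' γ 1 1 : ℂ)) ^ k₂ * f p) :
    (¬(0 < k₁ ∧ 0 < k₂) → ¬(k₁ = 0 ∧ k₂ = 0) →
      ∀ p : ℂ × ℂ, 0 < p.1.im → 0 < p.2.im → f p = 0) ∧
    (k₁ = 0 → k₂ = 0 →
      ∀ p q : ℂ × ℂ, 0 < p.1.im → 0 < p.2.im → 0 < q.1.im → 0 < q.2.im → f p = f q) := by
  have hsq : ¬ IsSquare d := by
    rintro ⟨m, hm⟩
    have h1 : IsUnit m := hsf m ⟨1, by rw [hm, mul_one]⟩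
    rcases Int.isUnit_iff.1 h1 with h | h <;> rw [h] at hm <;> omega
  have hIntl : IsIntegral ℤ sqrtd := by
    apply IsIntegral.of_pow (n := 2) two_pos
    rw [hsqrtd]
    exact isIntegral_algebraMap (R := ℤ) (A := F) (x := d)
  let r : NumberField.RingOfIntegers F := ⟨sqrtd, hIntl⟩
  have hr : (r : F) ^ 2 = d := hsqrtd
  set s : ℝ := σ sqrtd with hs
  have hs2 : s ^ 2 = d := by rw [hs, ← map_pow, hsqrtd, map_intCast]
  have hs2' : (σ' sqrtd) ^ 2 = d := by rw [← map_pow, hsqrtd, map_intCast]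
  have hd0 : (0 : ℝ) < d := by exact_mod_cast (by omega : 0 < d)
  have hs0 : s ≠ 0 := by
    intro h
    rw [h] at hs2
    norm_num at hs2
    rw [← hs2] at hd0
    exact lt_irrefl _ hd0
  have hσ1 : σ (r : F) = s := rfl
  have hσ2 : σ' (r : F) = -s := by
    change σ' sqrtd = -s
    rcases sq_eq_sq_iff_eq_or_eq_neg.1 (hs2'.trans hs2.symm) with h | h
    · exfalso
      exact hσ (embeddings_eq hrank sqrtd (not_rational hsq hsqrtd) (h.symm))
    · exact h
  have hHH : {p : ℂ × ℂ | 0 < p.1.im ∧ 0 < p.2.im} = HH := rfl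
  rw [hHH] at hf
  have hmod1 : ∀ γ : Matrix.SpecialLinearGroup (Fin 2) (NumberField.RingOfIntegers F), ∀ p ∈ HH,
      f (act σ σ' (toF γ) p) = autf σ σ' k₁ k₂ (toF γ) p * f p :=
    fun γ p hp => hmod γ p hp.1 hp.2
  refine ⟨fun h1 h2 p hp1 hp2 => ?_, fun h1 h2 p q hp1 hp2 hq1 hq2 => ?_⟩
  · by_cases hk : k₁ ≤ 0
    · exact core_zero hrank σ σ' hσ hk h2 r hs0 hσ1 hσ2 hd hsq hr hf hmod1 p ⟨hp1, hp2⟩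
    · have hk2 : k₂ ≤ 0 := by
        by_contra h3
        exact h1 ⟨by omega, by omega⟩
      have hf' : DifferentiableOn ℂ (fun p : ℂ × ℂ => f (p.2, p.1)) HH := by
        apply hf.comp (by fun_prop : DifferentiableOn ℂ (fun p : ℂ × ℂ => (p.2, p.1)) HH)
        intro x hx
        exact ⟨hx.2, hx.1⟩
      have hmod2 : ∀ γ : Matrix.SpecialLinearGroup (Fin 2) (NumberField.RingOfIntegers F),
          ∀ p ∈ HH, (fun p : ℂ × ℂ => f (p.2, p.1)) (act σ' σ (toF γ) p) =
            autf σ' σ k₂ k₁ (toF γ) p * (fun p : ℂ × ℂ => f (p.2, p.1)) p := by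
        intro γ p hp
        have h3 := hmod1 γ (p.2, p.1) ⟨hp.2, hp.1⟩
        have h4 : autf σ' σ k₂ k₁ (toF γ) p = autf σ σ' k₁ k₂ (toF γ) (p.2, p.1) := by
          simp only [autf]
          ring
        rw [h4]
        exact h3
      exact core_zero hrank σ' σ hσ.symm hk2 (fun h => h2 ⟨h.2, h.1⟩) r (s := -s) (neg_ne_zero.2 hs0)
        hσ2 (by rw [neg_neg]; exact hσ1) hd hsq hr hf' hmod2 (p.2, p.1) ⟨hp2, hp1⟩
  · obtain ⟨a, ha⟩ := (core hrank σ σ' hσ h1.le r hs0 hσ1 hσ2 hd hsq hr hf hmod1).2 h1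
    rw [ha p ⟨hp1, hp2⟩, ha q ⟨hq1, hq2⟩]
end

section
/- Let k be a field of characteristic ≠ 2 and (V,Q) a nondegenerate quadratic space over k with dim V ≤ 4. Then the set of elements of the odd part C_V¹ of the Clifford algebra fixed by the canonical involution equals the image of V: {g ∈ C_V¹ : gᵗ = g} = ι(V). -/
open CliffordAlgebra in
/-- Spanning argument: with four pairwise anticommuting generators, the odd part lies in the
submodule of elements `x` with `x + xᵗ ∈ ι(V)`. -/
theorem odd_le_aux {k V : Type*} [Field k] [AddCommGroup V] [Module k V]
    (Q : QuadraticForm k V) (e : Fin 4 → V)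
    (hspan : Submodule.span k (Set.range e) = ⊤)
    (horth : ∀ i j, i ≠ j → QuadraticMap.polar Q (e i) (e j) = 0)
    (g : CliffordAlgebra Q) (hg : g ∈ evenOdd Q 1) :
    g + reverse (Q := Q) g ∈ LinearMap.range (ι Q) := by
  obtain ⟨a, ha⟩ : ∃ a, a = ι Q (e 0) := ⟨_, rfl⟩
  obtain ⟨b, hb⟩ : ∃ a, a = ι Q (e 1) := ⟨_, rfl⟩
  obtain ⟨c, hc⟩ : ∃ a, a = ι Q (e 2) := ⟨_, rfl⟩
  obtain ⟨d, hd⟩ : ∃ a, a = ι Q (e 3) := ⟨_, rfl⟩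
  have sq : ∀ i, ι Q (e i) * ι Q (e i) = Q (e i) • (1 : CliffordAlgebra Q) := by
    intro i
    rw [ι_sq_scalar, Algebra.algebraMap_eq_smul_one]
  have anti : ∀ i j, i ≠ j → ι Q (e i) * ι Q (e j) = -(ι Q (e j) * ι Q (e i)) := by
    intro i j hij
    have := ι_mul_ι_add_swap (Q := Q) (e i) (e j)
    rw [horth i j hij, map_zero] at this
    exact eq_neg_of_add_eq_zero_left this
  have haa := sq 0
  have hbb := sq 1
  have hcc := sq 2
  have hdd := sq 3
  have hba := anti 1 0 (by decide)
  have hca := anti 2 0 (by decide)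
  have hda := anti 3 0 (by decide)
  have hcb := anti 2 1 (by decide)
  have hdb := anti 3 1 (by decide)
  have hdc := anti 3 2 (by decide)
  rw [← ha] at haa hba hca hda
  rw [← hb] at hbb hba hcb hdb
  rw [← hc] at hcc hca hcb hdc
  rw [← hd] at hdd hda hdb hdc
  have sq' : ∀ {x : CliffordAlgebra Q} {r : k}, x * x = r • (1 : CliffordAlgebra Q) →
      ∀ z, x * (x * z) = r • z := by
    intro x r h z
    rw [← mul_assoc, h, smul_mul_assoc, one_mul]
  have anti' : ∀ {x y : CliffordAlgebra Q}, x * y = -(y * x) →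
      ∀ z, x * (y * z) = -(y * (x * z)) := by
    intro x y h z
    rw [← mul_assoc, h, neg_mul, mul_assoc]
  have haa' := sq' haa
  have hbb' := sq' hbb
  have hcc' := sq' hcc
  have hdd' := sq' hdd
  have hba' := anti' hba
  have hca' := anti' hca
  have hda' := anti' hda
  have hcb' := anti' hcb
  have hdb' := anti' hdb
  have hdc' := anti' hdc
  let sO : Set (CliffordAlgebra Q) :=
    {a, b, c, d, a * (b * c), a * (b * d), a * (c * d), b * (c * d)}
  let sE : Set (CliffordAlgebra Q) :=
    {1, a * b, a * c, a * d, b * c, b * d, c * d, a * (b * (c * d))}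
  -- multiplication by a generator swaps the two spans
  have gen : ∀ (s t : Set (CliffordAlgebra Q)),
      (∀ y ∈ s, a * y ∈ Submodule.span k t ∧ b * y ∈ Submodule.span k t ∧
        c * y ∈ Submodule.span k t ∧ d * y ∈ Submodule.span k t) →
      ∀ v : V, ∀ x ∈ Submodule.span k s, ι Q v * x ∈ Submodule.span k t := by
    intro s t h v x hx
    induction hx using Submodule.span_induction with
    | zero => simp
    | add x y _ _ hx hy => rw [mul_add]; exact add_mem hx hy
    | smul r x _ hx => rw [mul_smul_comm]; exact Submodule.smul_mem _ _ hx
    | mem y hy =>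
      have hv : v ∈ Submodule.span k (Set.range e) := hspan ▸ Submodule.mem_top
      induction hv using Submodule.span_induction with
      | zero => simp
      | add x y _ _ hx hy => rw [map_add, add_mul]; exact add_mem hx hy
      | smul r x _ hx => rw [map_smul, smul_mul_assoc]; exact Submodule.smul_mem _ _ hx
      | mem z hz =>
        obtain ⟨i, rfl⟩ := hz
        obtain ⟨h0, h1, h2, h3⟩ := h y hy
        fin_cases i
        · exact ha ▸ h0
        · exact hb ▸ h1
        · exact hc ▸ h2
        · exact hd ▸ h3
  have mO : ∀ y ∈ sO, y ∈ Submodule.span k sO := fun y hy => Submodule.subset_span hy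
  have mE : ∀ y ∈ sE, y ∈ Submodule.span k sE := fun y hy => Submodule.subset_span hy
  have mO' := mO
  have mE' := mE
  simp only [sO, Set.mem_insert_iff, Set.mem_singleton_iff, forall_eq_or_imp, forall_eq] at mO'
  simp only [sE, Set.mem_insert_iff, Set.mem_singleton_iff, forall_eq_or_imp, forall_eq] at mE'
  obtain ⟨o1, o2, o3, o4, o5, o6, o7, o8⟩ := mO'
  obtain ⟨f1, f2, f3, f4, f5, f6, f7, f8⟩ := mE'
  have OE := gen sO sE (by
    intro y hy
    simp only [sO, Set.mem_insert_iff, Set.mem_singleton_iff] at hy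
    rcases hy with rfl | rfl | rfl | rfl | rfl | rfl | rfl | rfl <;>
    refine ⟨?_, ?_, ?_, ?_⟩ <;>
    try simp only [haa, hbb, hcc, hdd, hba, hca, hda, hcb, hdb, hdc, haa', hbb', hcc', hdd',
      hba', hca', hda', hcb', hdb', hdc', mul_neg, neg_neg, mul_smul_comm, mul_one,
      neg_mem_iff]
    all_goals
      first
      | assumption
      | exact Submodule.smul_mem _ _ (by assumption))
  have EO := gen sE sO (by
    intro y hy
    simp only [sE, Set.mem_insert_iff, Set.mem_singleton_iff] at hy
    rcases hy with rfl | rfl | rfl | rfl | rfl | rfl | rfl | rfl <;>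
    refine ⟨?_, ?_, ?_, ?_⟩ <;>
    try simp only [haa, hbb, hcc, hdd, hba, hca, hda, hcb, hdb, hdc, haa', hbb', hcc', hdd',
      hba', hca', hda', hcb', hdb', hdc', mul_neg, neg_neg, mul_smul_comm, mul_one,
      neg_mem_iff]
    all_goals
      first
      | assumption
      | exact Submodule.smul_mem _ _ (by assumption))
  have key : g ∈ Submodule.span k sO := by
    induction g, hg using odd_induction with
    | ι v => simpa using EO v 1 f1
    | add x y _ _ hx hy => exact add_mem hx hy
    | ι_mul_ι_mul m₁ m₂ x _ hx =>
      rw [mul_assoc]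
      exact EO _ _ (OE _ _ hx)
  clear hg
  have ra : reverse a = a := by rw [ha, reverse_ι]
  have rb : reverse b = b := by rw [hb, reverse_ι]
  have rc : reverse c = c := by rw [hc, reverse_ι]
  have rd : reverse d = d := by rw [hd, reverse_ι]
  induction key using Submodule.span_induction with
  | zero => simp
  | add x y _ _ hx hy =>
    rw [map_add, add_add_add_comm]; exact add_mem hx hy
  | smul r x _ hx => rw [map_smul, ← smul_add]; exact Submodule.smul_mem _ _ hx
  | mem y hy =>
    have ia : a ∈ LinearMap.range (ι Q) := ⟨_, ha.symm⟩
    have ib : b ∈ LinearMap.range (ι Q) := ⟨_, hb.symm⟩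
    have ic : c ∈ LinearMap.range (ι Q) := ⟨_, hc.symm⟩
    have id : d ∈ LinearMap.range (ι Q) := ⟨_, hd.symm⟩
    simp only [sO, Set.mem_insert_iff, Set.mem_singleton_iff] at hy
    rcases hy with rfl | rfl | rfl | rfl | rfl | rfl | rfl | rfl <;>
    try simp only [reverse.map_mul, ra, rb, rc, rd, mul_assoc, hba, hca, hda, hcb, hdb, hdc,
      hba', hca', hda', hcb', hdb', hdc', neg_mul, mul_neg, neg_neg, add_neg_cancel]
    all_goals
      first
      | exact zero_mem _
      | exact add_mem (by assumption) (by assumption)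

/-- For a nondegenerate quadratic space of dimension `≤ 4` over a field of characteristic
`≠ 2`, the elements of the odd part of the Clifford algebra fixed by the canonical
involution are exactly the image of `V`: `{g ∈ C_V¹ : gᵗ = g} = ι(V)`. -/
theorem odd_reverse_fixed_eq_iota_range {k V : Type*} [Field k] [AddCommGroup V]
    [Module k V] [FiniteDimensional k V]
    (hchar : (2 : k) ≠ 0)
    (hdim : Module.finrank k V ≤ 4)
    (Q : QuadraticForm k V)
    (hnd : (QuadraticMap.polarBilin Q).Nondegenerate) :
    {g : CliffordAlgebra Q | g ∈ CliffordAlgebra.evenOdd Q 1 ∧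
        CliffordAlgebra.reverse (Q := Q) g = g}
      = Set.range (CliffordAlgebra.ι Q) := by
  haveI : Invertible (2 : k) := invertibleOfNonzero hchar
  have hsymm : LinearMap.IsSymm (QuadraticMap.polarBilin Q) :=
    ⟨fun x y => QuadraticMap.polar_comm Q x y⟩
  obtain ⟨v, hv⟩ := LinearMap.BilinForm.exists_orthogonal_basis hsymm
  let e : Fin 4 → V := fun i => if h : (i : ℕ) < Module.finrank k V then v ⟨i, h⟩ else 0
  have hspan : Submodule.span k (Set.range e) = ⊤ := by
    rw [eq_top_iff, ← v.span_eq]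
    apply Submodule.span_mono
    rintro _ ⟨i, rfl⟩
    refine ⟨⟨i, i.2.trans_le hdim⟩, ?_⟩
    simp [e]
  have horth : ∀ i j, i ≠ j → QuadraticMap.polar Q (e i) (e j) = 0 := by
    intro i j hij
    by_cases hi : (i : ℕ) < Module.finrank k V
    · by_cases hj : (j : ℕ) < Module.finrank k V
      · simp only [e, hi, hj, dif_pos]
        exact hv (i := ⟨i, hi⟩) (j := ⟨j, hj⟩) (by simpa [Fin.ext_iff] using hij)
      · simp [e, hj]
    · simp [e, hi]
  ext g
  constructor
  · rintro ⟨hg, hr⟩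
    obtain ⟨w, hw⟩ := odd_le_aux Q e hspan horth g hg
    refine ⟨(⅟2 : k) • w, ?_⟩
    rw [map_smul, hw, hr, ← two_smul k g, smul_smul, invOf_mul_self, one_smul]
  · rintro ⟨w, rfl⟩
    exact ⟨CliffordAlgebra.ι_mem_evenOdd_one Q w, CliffordAlgebra.reverse_ι w⟩
end

section
/- Let F = ℚ(√d) be a quadratic field (d ∈ ℚ^× not a square) with nontrivial automorphism ν ↦ ν′, and let V = ℚ ⊕ ℚ ⊕ F be the 4-dimensional rational quadratic space with quadratic form Q(a,b,ν) = νν′ − ab. Then there is an isomorphism of ℚ-algebras φ from the even Clifford algebra C_V⁰ of (V,Q) onto the matrix algebra M₂(F) under which the canonical involution corresponds to the adjugate: φ(xᵗ) = adj(φ(x)) for all x ∈ C_V⁰, where adj(a b; c d) = (d −b; −c a). In particular, the Clifford norm corresponds to the determinant: φ(xᵗ·x) = det(φ(x))·I for all x ∈ C_V⁰. -/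
open CliffordAlgebra in
/-- The finite dimension of the even Clifford algebra: half of `2 ^ dim V`. -/
theorem even_clifford_finrank_aux {M : Type*} [AddCommGroup M] [Module ℚ M]
    [Module.Finite ℚ M] (hM : Module.finrank ℚ M = 4) (Q : QuadraticForm ℚ M)
    (u : M) (hu : Q u = 1) :
    Module.Finite ℚ (even Q) ∧ Module.finrank ℚ (even Q) = 8 := by
  let b : Module.Basis (Fin 4) ℚ M := Module.finBasisOfFinrankEq ℚ M hM
  let c : Module.Basis (Finset (Fin 4)) ℚ (CliffordAlgebra Q) :=
    b.ExteriorAlgebra.map (equivExterior Q).symm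
  have hfin : Module.Finite ℚ (CliffordAlgebra Q) := Module.Finite.of_basis c
  have h16 : Module.finrank ℚ (CliffordAlgebra Q) = 16 := by
    rw [Module.finrank_eq_card_basis c]; simp
  have hsum := Submodule.finrank_add_eq_of_isCompl (evenOdd_isCompl Q)
  have huu : ι Q u * ι Q u = 1 := by rw [ι_sq_scalar, hu, map_one]
  have hcancel : ∀ x, ι Q u * (ι Q u * x) = x := fun x => by
    rw [← mul_assoc, huu, one_mul]
  have hinj : Function.Injective (LinearMap.mulLeft ℚ (ι Q u)) := fun x y h => by
    have := congrArg (fun z => ι Q u * z) h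
    simpa [hcancel] using this
  have h01 : (evenOdd Q 0).map (LinearMap.mulLeft ℚ (ι Q u)) ≤ evenOdd Q 1 := by
    rintro _ ⟨x, hx, rfl⟩
    have := SetLike.mul_mem_graded (ι_mem_evenOdd_one Q u) hx
    simpa using this
  have h10 : (evenOdd Q 1).map (LinearMap.mulLeft ℚ (ι Q u)) ≤ evenOdd Q 0 := by
    rintro _ ⟨x, hx, rfl⟩
    have h := SetLike.mul_mem_graded (ι_mem_evenOdd_one Q u) hx
    have h11 : (1 + 1 : ZMod 2) = 0 := by decide
    rw [h11] at h
    exact h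
  have l1 := Submodule.finrank_mono h01
  have l2 := Submodule.finrank_mono h10
  rw [← (Submodule.equivMapOfInjective _ hinj _).finrank_eq] at l1 l2
  have : Module.finrank ℚ (even Q) = Module.finrank ℚ (evenOdd Q 0) := rfl
  refine ⟨inferInstanceAs (Module.Finite ℚ (evenOdd Q 0)), by omega⟩

set_option maxHeartbeats 1000000 in
/-- For `F = ℚ(√d)` (`d` not a square) with nontrivial automorphism `ν ↦ ν′`, and the
quadratic space `V = ℚ ⊕ ℚ ⊕ F` with `Q(a,b,ν) = νν′ − ab`, the even Clifford algebra
`C_V⁰` is isomorphic as a ℚ-algebra to `M₂(F)`, with the canonical involution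
corresponding to the adjugate and the Clifford norm corresponding to the determinant. -/
theorem even_clifford_of_quadratic_field_iso_matrix
    (d : ℚ) (hd0 : d ≠ 0) (hdns : ∀ r : ℚ, r ^ 2 ≠ d)
    (F : Type*) [Field F] [Algebra ℚ F]
    (hrank : Module.finrank ℚ F = 2)
    (sqrtd : F) (hsq : sqrtd ^ 2 = algebraMap ℚ F d)
    (conj : F ≃ₐ[ℚ] F) (hconj : conj sqrtd = -sqrtd)
    (Q : QuadraticForm ℚ (ℚ × ℚ × F))
    (hQ : ∀ (a b : ℚ) (ν : F),
      algebraMap ℚ F (Q (a, b, ν)) = ν * conj ν - algebraMap ℚ F (a * b)) :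
    ∃ φ : CliffordAlgebra.even Q ≃ₐ[ℚ] Matrix (Fin 2) (Fin 2) F,
      (∀ x y : CliffordAlgebra.even Q,
        (y : CliffordAlgebra Q) = CliffordAlgebra.reverse (Q := Q) (x : CliffordAlgebra Q) →
          φ y = Matrix.adjugate (φ x)) ∧
      (∀ x z : CliffordAlgebra.even Q,
        (z : CliffordAlgebra Q)
            = CliffordAlgebra.reverse (Q := Q) (x : CliffordAlgebra Q) * (x : CliffordAlgebra Q) →
          φ z = Matrix.det (φ x) • (1 : Matrix (Fin 2) (Fin 2) F)) := by
  classical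
  have hinjQ : Function.Injective (algebraMap ℚ F) := (algebraMap ℚ F).injective
  have hFfin : Module.Finite ℚ F := Module.finite_of_finrank_pos (by omega)
  -- the bilinear map `(v, w) ↦ X_v * adj X_w`
  let X : (ℚ × ℚ × F) →ₗ[ℚ] Matrix (Fin 2) (Fin 2) F :=
    { toFun := fun v => !![v.2.2, algebraMap ℚ F v.1; algebraMap ℚ F v.2.1, conj v.2.2]
      map_add' := fun v w => by ext i j; fin_cases i <;> fin_cases j <;> simp [-eq_ratCast]
      map_smul' := fun r v => by
        ext i j; fin_cases i <;> fin_cases j <;> simp [-eq_ratCast, Algebra.smul_def] }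
  let Y : (ℚ × ℚ × F) →ₗ[ℚ] Matrix (Fin 2) (Fin 2) F :=
    { toFun := fun v => !![conj v.2.2, -algebraMap ℚ F v.1; -algebraMap ℚ F v.2.1, v.2.2]
      map_add' := fun v w => by ext i j; fin_cases i <;> fin_cases j <;> simp [-eq_ratCast, add_comm]
      map_smul' := fun r v => by
        ext i j; fin_cases i <;> fin_cases j <;> simp [-eq_ratCast, Algebra.smul_def] }
  have hX : ∀ v, X v =
    !![v.2.2, algebraMap ℚ F v.1; algebraMap ℚ F v.2.1, conj v.2.2] := fun _ => rfl
  have hY : ∀ v, Y v =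
    !![conj v.2.2, -algebraMap ℚ F v.1; -algebraMap ℚ F v.2.1, v.2.2] := fun _ => rfl
  have hXY : ∀ v, X v * Y v = algebraMap ℚ _ (Q v) := by
    rintro ⟨a, b, ν⟩
    have h := hQ a b ν
    rw [map_mul] at h
    rw [hX, hY, Matrix.algebraMap_eq_diagonal]
    ext i j
    fin_cases i <;> fin_cases j <;> simp [-eq_ratCast, Matrix.mul_apply, Fin.sum_univ_two, h] <;> ring
  have hYX : ∀ v, Y v * X v = algebraMap ℚ _ (Q v) := by
    rintro ⟨a, b, ν⟩
    have h := hQ a b ν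
    rw [map_mul] at h
    rw [hX, hY, Matrix.algebraMap_eq_diagonal]
    ext i j
    fin_cases i <;> fin_cases j <;> simp [-eq_ratCast, Matrix.mul_apply, Fin.sum_univ_two, h] <;> ring
  have hadjX : ∀ v, (X v).adjugate = Y v := fun v => by
    rw [hX, hY, Matrix.adjugate_fin_two_of]
  have hadjY : ∀ v, (Y v).adjugate = X v := fun v => by
    rw [hX, hY, Matrix.adjugate_fin_two_of]; simp
  let f : CliffordAlgebra.EvenHom Q (Matrix (Fin 2) (Fin 2) F) :=
    { bilin := (LinearMap.mul ℚ (Matrix (Fin 2) (Fin 2) F)).compl₁₂ X Y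
      contract := fun m => hXY m
      contract_mid := fun m₁ m₂ m₃ => by
        change X m₁ * Y m₂ * (X m₂ * Y m₃) = Q m₂ • (X m₁ * Y m₃)
        rw [mul_assoc, ← mul_assoc (Y m₂), hYX, Algebra.smul_def, Algebra.left_comm] }
  let φ₀ := CliffordAlgebra.even.lift Q f
  have hφ : ∀ v w, φ₀ ((CliffordAlgebra.even.ι Q).bilin v w) = X v * Y w := fun v w =>
    CliffordAlgebra.even.lift_ι Q f v w
  have hsurj : Function.Surjective φ₀ := by
    intro M
    refine ⟨(CliffordAlgebra.even.ι Q).bilin (1, 0, 0) (0, 0, M 0 0) *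
        (CliffordAlgebra.even.ι Q).bilin (0, 1, 0) (0, 0, 1) +
      (CliffordAlgebra.even.ι Q).bilin (1, 0, 0) (0, 0, M 0 1) +
      (CliffordAlgebra.even.ι Q).bilin (0, 1, 0) (0, 0, conj.symm (M 1 0)) +
      (CliffordAlgebra.even.ι Q).bilin (0, 1, 0) (0, 0, 1) *
        (CliffordAlgebra.even.ι Q).bilin (1, 0, 0) (0, 0, M 1 1), ?_⟩
    simp only [map_add, map_mul, hφ, hX, hY]
    ext i j
    fin_cases i <;> fin_cases j <;> simp [Matrix.mul_apply, Fin.sum_univ_two]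
  have hu : Q (0, 0, 1) = 1 := hinjQ (by rw [hQ]; simp)
  obtain ⟨hfin, h8⟩ := even_clifford_finrank_aux (M := ℚ × ℚ × F)
    (by simp [hrank]) Q (0, 0, 1) hu
  have hdim : Module.finrank ℚ (CliffordAlgebra.even Q) =
      Module.finrank ℚ (Matrix (Fin 2) (Fin 2) F) := by
    rw [h8, Module.finrank_matrix, hrank]; simp
  have hinj : Function.Injective φ₀ :=
    (LinearMap.injective_iff_surjective_of_finrank_eq_finrank (f := φ₀.toLinearMap) hdim).2 hsurj
  have hadj_add : ∀ A B : Matrix (Fin 2) (Fin 2) F,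
      (A + B).adjugate = A.adjugate + B.adjugate := fun A B => by
    simp only [Matrix.adjugate_fin_two]
    ext i j
    fin_cases i <;> fin_cases j <;> simp [add_comm]
  -- compatibility with the canonical involution
  have key : ∀ (x : CliffordAlgebra Q) (hx : x ∈ CliffordAlgebra.evenOdd Q 0),
      ∃ y : CliffordAlgebra.even Q, (y : CliffordAlgebra Q) = CliffordAlgebra.reverse (Q := Q) x ∧
        φ₀ y = (φ₀ ⟨x, hx⟩).adjugate := by
    intro x hx
    induction x, hx using CliffordAlgebra.even_induction with
    | algebraMap r =>
      refine ⟨algebraMap ℚ _ r, by simp [CliffordAlgebra.reverse.commutes], ?_⟩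
      have : φ₀ ⟨algebraMap ℚ (CliffordAlgebra Q) r, SetLike.algebraMap_mem_graded _ _⟩ =
        algebraMap ℚ _ r := φ₀.commutes r
      rw [this, φ₀.commutes, Matrix.algebraMap_eq_diagonal, Matrix.adjugate_fin_two]
      ext i j
      fin_cases i <;> fin_cases j <;> simp
    | add x y hx hy ihx ihy =>
      obtain ⟨x', hx', ex⟩ := ihx
      obtain ⟨y', hy', ey⟩ := ihy
      refine ⟨x' + y', by simp [hx', hy'], ?_⟩
      have : φ₀ ⟨x + y, Submodule.add_mem _ hx hy⟩ = φ₀ ⟨x, hx⟩ + φ₀ ⟨y, hy⟩ :=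
        map_add φ₀ ⟨x, hx⟩ ⟨y, hy⟩
      rw [this, hadj_add, map_add, ex, ey]
    | ι_mul_ι_mul m₁ m₂ x hx ih =>
      obtain ⟨x', hx', ex⟩ := ih
      refine ⟨x' * (CliffordAlgebra.even.ι Q).bilin m₂ m₁, ?_, ?_⟩
      · rw [CliffordAlgebra.reverse.map_mul, CliffordAlgebra.reverse.map_mul,
          CliffordAlgebra.reverse_ι, CliffordAlgebra.reverse_ι, ← hx']
        rfl
      · have : ∀ h, φ₀ ⟨CliffordAlgebra.ι Q m₁ * CliffordAlgebra.ι Q m₂ * x, h⟩ =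
            φ₀ ((CliffordAlgebra.even.ι Q).bilin m₁ m₂) * φ₀ ⟨x, hx⟩ := fun h =>
          map_mul φ₀ ((CliffordAlgebra.even.ι Q).bilin m₁ m₂) ⟨x, hx⟩
        refine Eq.trans ?_ (congrArg Matrix.adjugate (this _)).symm
        rw [map_mul, Matrix.adjugate_mul_distrib, hφ, hφ, Matrix.adjugate_mul_distrib,
          hadjX, hadjY, ex]
  have key' : ∀ x y : CliffordAlgebra.even Q,
      (y : CliffordAlgebra Q) = CliffordAlgebra.reverse (Q := Q) (x : CliffordAlgebra Q) →
        φ₀ y = (φ₀ x).adjugate := by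
    rintro ⟨x, hx⟩ y hy
    obtain ⟨y', hy', e⟩ := key x hx
    have : y = y' := Subtype.ext (hy.trans hy'.symm)
    rw [this, e]
  refine ⟨AlgEquiv.ofBijective φ₀ ⟨hinj, hsurj⟩, key', ?_⟩
  intro x z hz
  obtain ⟨y, hy, -⟩ := key x.1 x.2
  have hzy : z = y * x := Subtype.ext (by rw [hz, ← hy]; rfl)
  change φ₀ z = (φ₀ x).det • 1
  rw [hzy, map_mul, key' x y hy, Matrix.adjugate_mul]
end
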